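/- Assume the continuous problem (M_{μ⁰}) has a unique solution Q_min, and let Q_N be a minimizer of (M_{N, μ⁰_N, ε_N}) for each N, with parameters ε_N and μ⁰_N chosen such that (up to a subsequence) Q_N converges narrowly to Q_min and J_{ε_N}(Q_N) converges to J(Q_min). Define ρ_N(t) = argmin_ρ [ W₂²(ρ, e_t#Q_N)/(2ε_N) + ∫_Ω f(ρ(x)) dx ]. Then lim_{N→∞} ∫₀^T ∫_Ω f(ρ_N(t)(x)) dx dt = ∫₀^T ∫_Ω f( (e_t#Q_min)(x) ) dx dt. -/

import Mathlib

open MeasureTheory Filter Topology Set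
open scoped ENNReal NNReal Classical

noncomputable section

abbrev Euc (d : ℕ) : Type := EuclideanSpace ℝ (Fin d)

abbrev Traj (d : ℕ) (T : ℝ) : Type := C(Set.Icc (0:ℝ) T, Euc d)

instance (d : ℕ) (T : ℝ) : MeasurableSpace (Traj d T) := borel _
instance (d : ℕ) (T : ℝ) : BorelSpace (Traj d T) := ⟨rfl⟩

/-- evaluation of a trajectory at time `t ∈ ℝ` (projected onto `[0,T]`). -/
def evalAt {d : ℕ} {T : ℝ} (hT : 0 ≤ T) (t : ℝ) (γ : Traj d T) : Euc d :=
  γ (Set.projIcc 0 T hT t)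

/-- Narrow convergence of a sequence of measures. -/
def NarrowTendsto {X : Type*} [TopologicalSpace X] [MeasurableSpace X]
    (μ : ℕ → Measure X) (ν : Measure X) : Prop :=
  ∀ f : BoundedContinuousFunction X ℝ,
    Tendsto (fun n => ∫ x, f x ∂(μ n)) atTop (𝓝 (∫ x, f x ∂ν))

/-- Squared 2-Wasserstein distance. -/
def W2sq {X : Type*} [MeasurableSpace X] [PseudoMetricSpace X]
    (μ ν : Measure X) : ℝ≥0∞ :=
  ⨅ (π : Measure (X × X)) (_ : π.map Prod.fst = μ ∧ π.map Prod.snd = ν),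
    ∫⁻ p, ENNReal.ofReal (dist p.1 p.2 ^ 2) ∂π

/-- Uniform discrete probability measures on `N` points. -/
def IsUnifDiscrete {X : Type*} [MeasurableSpace X] (N : ℕ) (μ : Measure X) : Prop :=
  ∃ x : Fin N → X, μ = ((N : ℝ≥0∞))⁻¹ • ∑ i, MeasureTheory.Measure.dirac (x i)

/-- Shifted (by `+C`) kinetic action: equals `∫₀ᵀ (L(γ'(t)) + C) dt` if `γ ∈ W^{1,r}`,
`+∞` otherwise. -/
def actionN {d : ℕ} {T : ℝ} (L : Euc d → ℝ) (C : ℝ) (γ : Traj d T) : ℝ≥0∞ :=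
  sInf { a : ℝ≥0∞ | ∃ g : ℝ → Euc d, IntervalIntegrable g volume 0 T ∧
      (∀ s t : Set.Icc (0:ℝ) T, γ t - γ s = ∫ u in (s:ℝ)..(t:ℝ), g u) ∧
      a = ∫⁻ t in Set.Ioc (0:ℝ) T, ENNReal.ofReal (L (g t) + C) }

/-- Kinetic part of the energy: `∫_Γ L(γ) dQ(γ)`. -/
def kinE {d : ℕ} {T : ℝ} (L : Euc d → ℝ) (C : ℝ) (Q : Measure (Traj d T)) : EReal :=
  ((∫⁻ γ, actionN L C γ ∂Q : ℝ≥0∞) : EReal) - ((C * T : ℝ) : EReal)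

/-- The mean-field game energy `J`. -/
def Jfun {d : ℕ} {T : ℝ} (hT : 0 ≤ T) (L : Euc d → ℝ) (C : ℝ)
    (F : Measure (Euc d) → ℝ≥0∞) (G : Measure (Traj d T) → ℝ)
    (Q : Measure (Traj d T)) : EReal :=
  kinE L C Q
    + ((∫⁻ t in Set.Ioc (0:ℝ) T, F (Q.map (evalAt hT t)) : ℝ≥0∞) : EReal)
    + ((G Q : ℝ) : EReal)

/-- Moreau envelope of `F` with parameter `ε` in the 2-Wasserstein space. -/
def moreau {d : ℕ} (Ω : Set (Euc d)) (F : Measure (Euc d) → ℝ≥0∞) (ε : ℝ)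
    (μ : Measure (Euc d)) : ℝ≥0∞ :=
  ⨅ (ρ : Measure (Euc d)) (_ : IsProbabilityMeasure ρ ∧ ρ Ωᶜ = 0),
    W2sq μ ρ / ENNReal.ofReal (2 * ε) + F ρ

/-- The regularized energy `J_ε`. -/
def Jeps {d : ℕ} {T : ℝ} (hT : 0 ≤ T) (Ω : Set (Euc d)) (L : Euc d → ℝ) (C : ℝ)
    (F : Measure (Euc d) → ℝ≥0∞) (G : Measure (Traj d T) → ℝ) (ε : ℝ)
    (Q : Measure (Traj d T)) : EReal :=
  kinE L C Q
    + ((∫⁻ t in Set.Ioc (0:ℝ) T, moreau Ω F ε (Q.map (evalAt hT t)) : ℝ≥0∞) : EReal)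
    + ((G Q : ℝ) : EReal)


/-- positive part of an extended real number, as an element of `ℝ≥0∞` -/
def ERtoENN (x : EReal) : ℝ≥0∞ := if x = ⊤ then ⊤ else ENNReal.ofReal x.toReal

/-- integral of an `EReal`-valued function (positive part minus negative part) -/
def eintegral {α : Type*} [MeasurableSpace α] (μ : Measure α) (g : α → EReal) : EReal :=
  ((∫⁻ a, ERtoENN (g a) ∂μ : ℝ≥0∞) : EReal) - ((∫⁻ a, ERtoENN (-(g a)) ∂μ : ℝ≥0∞) : EReal)

/-- the congestion functional `F(ρ) = ∫_Ω f(ρ(x)) dx` if `ρ ≪ dx`, `+∞` otherwise -/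
def intFE {d : ℕ} (Ω : Set (Euc d)) (f : ℝ → EReal) (ρ : Measure (Euc d)) : EReal :=
  if ρ ≪ volume then
    eintegral (volume.restrict Ω) (fun x => f ((ρ.rnDeriv volume x).toReal))
  else ⊤

/-- convexity of an `EReal`-valued function on `ℝ` -/
def ConvexE (f : ℝ → EReal) : Prop :=
  ∀ a b : ℝ, ∀ u ∈ Set.Icc (0:ℝ) 1,
    f (u * a + (1 - u) * b) ≤ ((u : ℝ) : EReal) * f a + (((1 - u : ℝ)) : EReal) * f b

/-- superlinearity of an `EReal`-valued function on `ℝ` -/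
def SuperlinearE (f : ℝ → EReal) : Prop :=
  ∀ K : ℝ, ∃ M : ℝ, ∀ t : ℝ, M ≤ |t| → ((K * |t| : ℝ) : EReal) ≤ f t

/-- Moreau envelope (for a possibly `EReal`-valued congestion functional). -/
def moreauE {d : ℕ} (Ω : Set (Euc d)) (FE : Measure (Euc d) → EReal) (ε : ℝ)
    (μ : Measure (Euc d)) : EReal :=
  ⨅ (ρ : Measure (Euc d)) (_ : IsProbabilityMeasure ρ ∧ ρ Ωᶜ = 0),
    (((W2sq μ ρ / ENNReal.ofReal (2 * ε)) : ℝ≥0∞) : EReal) + FE ρ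

/-- the energy `J` with congestion `F(ρ) = ∫_Ω f(ρ) dx` -/
def JfunE {d : ℕ} {T : ℝ} (hT : 0 ≤ T) (Ω : Set (Euc d)) (L : Euc d → ℝ) (C : ℝ)
    (f : ℝ → EReal) (G : Measure (Traj d T) → ℝ) (Q : Measure (Traj d T)) : EReal :=
  kinE L C Q
    + eintegral (volume.restrict (Set.Ioc (0:ℝ) T))
        (fun t => intFE Ω f (Q.map (evalAt hT t)))
    + ((G Q : ℝ) : EReal)

/-- the regularized energy `J_ε` with congestion `F(ρ) = ∫_Ω f(ρ) dx` -/
def JepsE {d : ℕ} {T : ℝ} (hT : 0 ≤ T) (Ω : Set (Euc d)) (L : Euc d → ℝ) (C : ℝ)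
    (f : ℝ → EReal) (G : Measure (Traj d T) → ℝ) (ε : ℝ)
    (Q : Measure (Traj d T)) : EReal :=
  kinE L C Q
    + eintegral (volume.restrict (Set.Ioc (0:ℝ) T))
        (fun t => moreauE Ω (intFE Ω f) ε (Q.map (evalAt hT t)))
    + ((G Q : ℝ) : EReal)


theorem jensen_lint {d : ℕ} (L : Euc d → ℝ) (C : ℝ) (hLconv : ConvexOn ℝ Set.univ L)
    (hLcont : Continuous L) (hpos : ∀ p, 0 ≤ L p + C) (g : ℝ → Euc d) (t h : ℝ) (hh : 0 < h)
    (hg : IntegrableOn g (Ioc t (t+h))) :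
    ENNReal.ofReal (L (h⁻¹ • ∫ u in t..(t+h), g u) + C) ≤
      ENNReal.ofReal h⁻¹ * ∫⁻ u in Ioc t (t+h), ENNReal.ofReal (L (g u) + C) := by
  have hvol : volume (Ioc t (t+h)) = ENNReal.ofReal h := by simp
  by_cases hfin : ∫⁻ u in Ioc t (t+h), ENNReal.ofReal (L (g u) + C) = ⊤
  · rw [hfin, ENNReal.mul_top]
    · exact le_top
    · simpa using hh
  have hmeas : AEStronglyMeasurable (fun u => L (g u) + C) (volume.restrict (Ioc t (t+h))) :=
    (hLcont.comp_aestronglyMeasurable hg.1).add aestronglyMeasurable_const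
  have hIntg : IntegrableOn (fun u => L (g u) + C) (Ioc t (t+h)) := by
    refine ⟨hmeas, ?_⟩
    rw [hasFiniteIntegral_iff_ofReal (Eventually.of_forall fun u => hpos _)]
    exact lt_top_iff_ne_top.2 hfin
  have hconv : ConvexOn ℝ Set.univ (fun p => L p + C) := hLconv.add_const C
  have := hconv.map_set_average_le (μ := volume) (t := Ioc t (t+h)) (f := g)
    (by fun_prop) isClosed_univ (by rw [hvol]; simpa using hh) (by rw [hvol]; simp) (by simp) hg hIntg
  rw [setAverage_eq, setAverage_eq] at this
  have hr : volume.real (Ioc t (t+h)) = h := by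
    rw [Measure.real, hvol, ENNReal.toReal_ofReal hh.le]
  rw [hr, ← intervalIntegral.integral_of_le (by linarith)] at this
  refine (ENNReal.ofReal_le_ofReal this).trans ?_
  rw [smul_eq_mul, ENNReal.ofReal_mul (by positivity),
    ofReal_integral_eq_lintegral_ofReal hIntg (Eventually.of_forall fun u => hpos _)]

/-- Steklov-type approximation of the action. -/
def stek {d : ℕ} {T : ℝ} (hT : 0 ≤ T) (L : Euc d → ℝ) (C : ℝ) (h : ℝ) (γ : Traj d T) : ℝ≥0∞ :=
  ∫⁻ t in Ioc (0:ℝ) T, ENNReal.ofReal (L (h⁻¹ • (evalAt hT (t+h) γ - evalAt hT t γ)) + C)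

theorem stek_le_aux {d : ℕ} {T : ℝ} (hT : 0 ≤ T) (L : Euc d → ℝ) (C : ℝ)
    (hLconv : ConvexOn ℝ Set.univ L)
    (hLcont : Continuous L) (hpos : ∀ p, 0 ≤ L p + C) (h : ℝ) (hh : 0 < h) (γ : Traj d T)
    (g : ℝ → Euc d) (hgm : Measurable g) (hg : IntervalIntegrable g volume 0 T)
    (hγ : ∀ s t : Set.Icc (0:ℝ) T, γ t - γ s = ∫ u in (s:ℝ)..(t:ℝ), g u) :
    stek hT L C h γ ≤ (∫⁻ t in Set.Ioc (0:ℝ) T, ENNReal.ofReal (L (g t) + C))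
      + ENNReal.ofReal (h * (L 0 + C)) := by
  set g0 : ℝ → Euc d := (Ioc 0 T).indicator g with hg0
  have hg0m : Measurable g0 := hgm.indicator measurableSet_Ioc
  have hg0i : Integrable g0 := by
    rw [hg0, integrable_indicator_iff measurableSet_Ioc]
    exact (intervalIntegrable_iff_integrableOn_Ioc_of_le hT).1 hg
  set φ : ℝ → ℝ≥0∞ := fun u => ENNReal.ofReal (L (g0 u) + C) with hφ
  have hφm : Measurable φ := by
    have := hLcont.measurable
    fun_prop
  have key : ∀ t ∈ Ioc (0:ℝ) T, evalAt hT (t+h) γ - evalAt hT t γ = ∫ u in t..(t+h), g0 u := by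
    intro t ht
    have h1 : evalAt hT t γ = γ ⟨t, ht.1.le, ht.2⟩ := by
      rw [evalAt, projIcc_of_mem hT ⟨ht.1.le, ht.2⟩]
    have hm : min T (t+h) ∈ Icc 0 T := ⟨le_min hT (by linarith [ht.1]), min_le_left _ _⟩
    have h2 : evalAt hT (t+h) γ = γ ⟨min T (t+h), hm⟩ := by
      rw [evalAt]; congr 1; apply Subtype.ext; rw [coe_projIcc]; exact max_eq_right hm.1
    have htm : t ≤ min T (t+h) := le_min ht.2 (by linarith)
    rw [h1, h2, hγ, ← intervalIntegral.integral_add_adjacent_intervals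
      (b := min T (t+h)) hg0i.intervalIntegrable hg0i.intervalIntegrable]
    have e1 : ∫ u in t..(min T (t+h)), g0 u = ∫ u in t..(min T (t+h)), g u := by
      apply intervalIntegral.integral_congr_ae
      refine Eventually.of_forall fun u hu => ?_
      rw [uIoc_of_le htm] at hu
      rw [hg0, indicator_of_mem]
      exact ⟨ht.1.trans hu.1, hu.2.trans (min_le_left _ _)⟩
    have e2 : ∫ u in (min T (t+h))..(t+h), g0 u = 0 := by
      apply intervalIntegral.integral_zero_ae
      refine Eventually.of_forall fun u hu => ?_
      rw [uIoc_of_le (min_le_right _ _)] at hu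
      rw [hg0, indicator_of_notMem]
      intro hu'
      have := hu.1
      rw [min_lt_iff] at this
      rcases this with h' | h' <;> linarith [hu.2, hu'.2]
    rw [e1, e2, add_zero]
  calc stek hT L C h γ ≤ ∫⁻ t in Ioc (0:ℝ) T, ENNReal.ofReal h⁻¹ * ∫⁻ u in Ioc t (t+h), φ u := by
        apply setLIntegral_mono' measurableSet_Ioc
        intro t ht
        rw [key t ht]
        exact jensen_lint L C hLconv hLcont hpos g0 t h hh hg0i.integrableOn
    _ = ∫⁻ t in Ioc (0:ℝ) T, ENNReal.ofReal h⁻¹ * ∫⁻ s in Ioc 0 h, φ (t + s) := by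
        congr with t
        congr 1
        have : Ioc 0 h = (fun s => t + s) ⁻¹' (Ioc t (t+h)) := by
          ext s; simp
        rw [this, (measurePreserving_add_left volume t).setLIntegral_comp_preimage
          measurableSet_Ioc hφm]
    _ = ENNReal.ofReal h⁻¹ * ∫⁻ t in Ioc (0:ℝ) T, ∫⁻ s in Ioc 0 h, φ (t + s) := by
        rw [lintegral_const_mul' _ _ ENNReal.ofReal_ne_top]
    _ = ENNReal.ofReal h⁻¹ * ∫⁻ s in Ioc 0 h, ∫⁻ t in Ioc (0:ℝ) T, φ (t + s) := by
        rw [lintegral_lintegral_swap]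
        exact (hφm.comp (measurable_fst.add measurable_snd)).aemeasurable
    _ ≤ ENNReal.ofReal h⁻¹ * ∫⁻ s in Ioc 0 h, ∫⁻ u in Ioc (0:ℝ) (T+h), φ u := by
        gcongr ENNReal.ofReal h⁻¹ * ?_
        apply setLIntegral_mono' measurableSet_Ioc
        intro s hs
        calc ∫⁻ t in Ioc (0:ℝ) T, φ (t + s) ≤ ∫⁻ t in (fun t => t + s) ⁻¹' (Ioc (0:ℝ) (T+h)), φ (t + s) := by
              apply lintegral_mono_set
              intro t ht
              exact ⟨by have := ht.1; have := hs.1; simp; linarith, by have := ht.2; have := hs.2; simp; linarith⟩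
          _ = _ := (measurePreserving_add_right volume s).setLIntegral_comp_preimage
                measurableSet_Ioc hφm
    _ = ∫⁻ u in Ioc (0:ℝ) (T+h), φ u := by
        rw [setLIntegral_const, Real.volume_Ioc, sub_zero, mul_comm, mul_assoc,
          ← ENNReal.ofReal_mul hh.le, mul_inv_cancel₀ hh.ne']
        simp
    _ = (∫⁻ u in Ioc (0:ℝ) T, φ u) + ∫⁻ u in Ioc T (T+h), φ u := by
        rw [← Ioc_union_Ioc_eq_Ioc hT (by linarith : T ≤ T + h),
          lintegral_union measurableSet_Ioc]
        exact Ioc_disjoint_Ioc_of_le le_rfl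
    _ = _ := by
        congr 1
        · apply setLIntegral_congr_fun measurableSet_Ioc
          intro u hu
          simp only [hφ, hg0, indicator_of_mem hu]
        · rw [ENNReal.ofReal_mul hh.le]
          have : ∫⁻ u in Ioc T (T+h), φ u = ∫⁻ u in Ioc T (T+h), ENNReal.ofReal (L 0 + C) := by
            apply setLIntegral_congr_fun measurableSet_Ioc
            intro u hu
            simp only [hφ, hg0]
            rw [indicator_of_notMem]
            exact fun h' => absurd h'.2 (not_le.2 hu.1)
          rw [this, setLIntegral_const, Real.volume_Ioc, mul_comm]
          simp

theorem stek_le {d : ℕ} {T : ℝ} (hT : 0 ≤ T) (L : Euc d → ℝ) (C : ℝ)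
    (hLconv : ConvexOn ℝ Set.univ L)
    (hLcont : Continuous L) (hpos : ∀ p, 0 ≤ L p + C) (h : ℝ) (hh : 0 < h) (γ : Traj d T) :
    stek hT L C h γ ≤ actionN L C γ + ENNReal.ofReal (h * (L 0 + C)) := by
  rw [actionN, ← tsub_le_iff_right]
  apply le_sInf
  rintro a ⟨g, hg, hγ, rfl⟩
  rw [tsub_le_iff_right]
  have hg1 := (intervalIntegrable_iff_integrableOn_Ioc_of_le hT).1 hg
  obtain ⟨g', hg'm, hgg'⟩ := hg1.1.aemeasurable
  have hgg2 := (ae_restrict_iff' measurableSet_Ioc).1 hgg'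
  have := stek_le_aux hT L C hLconv hLcont hpos h hh γ g' hg'm
    ((intervalIntegrable_iff_integrableOn_Ioc_of_le hT).2 (hg1.congr hgg')) ?_
  · refine this.trans (le_of_eq ?_)
    congr 1
    apply lintegral_congr_ae
    filter_upwards [hgg'] with t ht
    rw [ht]
  · intro s t
    rw [hγ]
    apply intervalIntegral.integral_congr_ae
    filter_upwards [hgg2] with u hu hu'
    apply hu
    have := s.2; have := t.2
    rw [mem_uIoc] at hu'
    rcases hu' with h' | h'
    · exact ⟨s.2.1.trans_lt h'.1, h'.2.trans t.2.2⟩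
    · exact ⟨t.2.1.trans_lt h'.1, h'.2.trans s.2.2⟩

theorem growth_superlin {d : ℕ} {r C : ℝ} (hr : 1 < r) (hC : 0 < C) (L : Euc d → ℝ)
    (hLgrow : ∀ p : Euc d, 1 / (r * C) * ‖p‖ ^ r - C ≤ L p) (η : ℝ) (hη : 0 < η) :
    ∃ c : ℝ, 0 ≤ c ∧ ∀ p, ‖p‖ ≤ η * (L p + C) + c := by
  have ht : Tendsto (fun x : ℝ => x ^ (r-1)) atTop atTop := tendsto_rpow_atTop (by linarith)
  obtain ⟨X, hX⟩ := (ht.eventually_ge_atTop (r * C / η)).exists_forall_of_atTop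
  refine ⟨max X 0, le_max_right _ _, fun p => ?_⟩
  have h1 := hLgrow p
  have hrC : 0 < r * C := by positivity
  have h0 : 0 ≤ 1 / (r * C) * ‖p‖ ^ r := by positivity
  rcases le_total X ‖p‖ with h | h
  · rcases eq_or_lt_of_le (norm_nonneg p) with h' | h'
    · rw [← h']
      have : 0 ≤ η * (L p + C) := mul_nonneg hη.le (by linarith)
      have := le_max_right X 0
      linarith
    have h2 := hX _ h
    have h3 : ‖p‖ ^ r = ‖p‖ ^ (r-1) * ‖p‖ := by
      rw [← Real.rpow_add_one h'.ne']; ring_nf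
    have h4 : r * C / η * ‖p‖ ≤ ‖p‖ ^ r := by
      rw [h3]; gcongr
    have h5 : ‖p‖ ≤ η * (1 / (r * C) * ‖p‖ ^ r) := by
      calc ‖p‖ = η * (1 / (r * C) * (r * C / η * ‖p‖)) := by field_simp
        _ ≤ _ := by gcongr
    have h6 : η * (1 / (r * C) * ‖p‖ ^ r) ≤ η * (L p + C) := by gcongr; linarith
    have := le_max_right X 0
    linarith
  · have : 0 ≤ η * (L p + C) := mul_nonneg hη.le (by linarith)
    have := le_max_left X 0
    linarith

theorem evalAt_continuous {d : ℕ} {T : ℝ} (hT : 0 ≤ T) :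
    Continuous (fun p : ℝ × Traj d T => evalAt hT p.1 p.2) := by
  unfold evalAt
  have : Continuous (projIcc 0 T hT) := continuous_projIcc
  fun_prop

theorem evalAt_continuous_time {d : ℕ} {T : ℝ} (hT : 0 ≤ T) (γ : Traj d T) :
    Continuous (fun t : ℝ => evalAt hT t γ) :=
  (evalAt_continuous hT).comp (by fun_prop : Continuous fun t : ℝ => (t, γ))

theorem evalAt_continuous_traj {d : ℕ} {T : ℝ} (hT : 0 ≤ T) (t : ℝ) :
    Continuous (fun γ : Traj d T => evalAt hT t γ) :=
  (evalAt_continuous hT).comp (by fun_prop : Continuous fun γ : Traj d T => (t, γ))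

/-- Steklov mean -/
def smean {d : ℕ} (x : ℝ → Euc d) (h t : ℝ) : Euc d := h⁻¹ • ∫ u in t..(t+h), x u

theorem smean_sub {d : ℕ} (x : ℝ → Euc d) (hx : Continuous x) (h a b : ℝ) :
    smean x h b - smean x h a = ∫ t in a..b, h⁻¹ • (x (t+h) - x t) := by
  have hi : ∀ a b, IntervalIntegrable x volume a b := fun a b => hx.intervalIntegrable a b
  have hi' : IntervalIntegrable (fun t => x (t+h)) volume a b :=
    (by fun_prop : Continuous fun t => x (t+h)).intervalIntegrable a b
  rw [intervalIntegral.integral_smul, intervalIntegral.integral_sub hi' (hi a b),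
    intervalIntegral.integral_comp_add_right, smean, smean, ← smul_sub]
  congr 1
  have h1 := intervalIntegral.integral_add_adjacent_intervals (hi a b) (hi b (b+h))
  have h2 := intervalIntegral.integral_add_adjacent_intervals (hi a (a+h)) (hi (a+h) (b+h))
  rw [sub_eq_sub_iff_add_eq_add]
  rw [add_comm, h1, ← h2, add_comm]

theorem smean_tendsto {d : ℕ} (x : ℝ → Euc d) (hx : Continuous x) (t : ℝ) (h : ℕ → ℝ)
    (hpos : ∀ n, 0 < h n) (hlim : Tendsto h atTop (𝓝 0)) :
    Tendsto (fun n => smean x (h n) t) atTop (𝓝 (x t)) := by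
  have h1 : HasDerivAt (fun b => ∫ u in t..b, x u) (x t) t :=
    intervalIntegral.integral_hasDerivAt_right (by simp)
      (hx.stronglyMeasurableAtFilter _ _) hx.continuousAt
  have h2 := h1.tendsto_slope_zero_right
  have h3 : Tendsto h atTop (𝓝[>] 0) :=
    tendsto_nhdsWithin_iff.2 ⟨hlim, Eventually.of_forall hpos⟩
  have := h2.comp h3
  simpa [Function.comp_def, smean] using this

theorem ac_of_stek {d : ℕ} {T : ℝ} (hT : 0 ≤ T) {r C : ℝ} (hr : 1 < r) (hC : 0 < C)
    (L : Euc d → ℝ) (hLcont : Continuous L)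
    (hLgrow : ∀ p : Euc d, 1 / (r * C) * ‖p‖ ^ r - C ≤ L p)
    (hpos : ∀ p, 0 ≤ L p + C) (γ : Traj d T) (h : ℕ → ℝ)
    (hhpos : ∀ n, 0 < h n) (hhlim : Tendsto h atTop (𝓝 0)) (K : ℝ) (hK0 : 0 ≤ K)
    (hK : ∃ᶠ n in atTop, stek hT L C (h n) γ ≤ ENNReal.ofReal K) :
    AbsolutelyContinuousOnInterval (fun t => evalAt hT t γ) 0 T := by
  rw [absolutelyContinuousOnInterval_iff]
  intro ε hε
  set x := fun t => evalAt hT t γ with hxdef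
  have hx : Continuous x := evalAt_continuous_time hT γ
  obtain ⟨c, hc0, hc⟩ := growth_superlin hr hC L hLgrow (ε / (4 * (K + 1))) (by positivity)
  set η := ε / (4 * (K + 1)) with hη
  refine ⟨ε / (4 * (c + 1)), by positivity, ?_⟩
  rintro ⟨n, I⟩ hE hsum
  simp only at hsum ⊢
  set δ := ε / (4 * (c + 1)) with hδ
  -- bound at level h
  have main : ∃ᶠ k in atTop, ∑ i ∈ Finset.range n, dist (smean x (h k) (I i).1) (smean x (h k) (I i).2)
      ≤ η * K + c * δ := by
    refine hK.mono fun k hk => ?_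
    set q : ℝ → Euc d := fun t => (h k)⁻¹ • (x (t + h k) - x t) with hq
    have hqc : Continuous q := by fun_prop
    have hψc : Continuous fun t => L (q t) + C := by fun_prop
    have hψK : ∫ t in Ioc 0 T, (L (q t) + C) ≤ K := by
      rw [integral_eq_lintegral_of_nonneg_ae (Eventually.of_forall fun t => hpos _)
        hψc.aestronglyMeasurable]
      exact ENNReal.toReal_le_of_le_ofReal hK0 hk
    have hψi : IntegrableOn (fun t => L (q t) + C) (Ioc 0 T) :=
      (hψc.integrableOn_Icc).mono_set Ioc_subset_Icc_self
    have hψii : ∀ s, s ⊆ Ioc 0 T → IntegrableOn (fun t => L (q t) + C) s :=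
      fun s hs => hψi.mono_set hs
    have hsub : ∀ i ∈ Finset.range n, uIoc (I i).1 (I i).2 ⊆ Ioc 0 T := by
      intro i hi
      have := AbsolutelyContinuousOnInterval.uIoc_subset_of_mem_disjWithin hE (Finset.mem_range.1 hi)
      rwa [uIoc_of_le hT] at this
    have step : ∀ i ∈ Finset.range n, dist (smean x (h k) (I i).1) (smean x (h k) (I i).2) ≤
        η * (∫ t in uIoc (I i).1 (I i).2, (L (q t) + C)) + c * dist (I i).1 (I i).2 := by
      intro i hi
      have hI := hψii _ (hsub i hi)
      rw [dist_comm, dist_eq_norm, smean_sub x hx]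
      refine (intervalIntegral.norm_integral_le_integral_norm_uIoc).trans ?_
      calc ∫ t in uIoc (I i).1 (I i).2, ‖q t‖ ≤ ∫ t in uIoc (I i).1 (I i).2, (η * (L (q t) + C) + c) := by
            apply integral_mono_of_nonneg (Eventually.of_forall fun t => norm_nonneg _)
            · refine (hI.const_mul _).add ?_
              apply integrableOn_const <;> simp [uIoc]
            · exact Eventually.of_forall fun t => hc _
        _ = _ := by
            rw [integral_add (hI.const_mul _) (by apply integrableOn_const <;> simp [uIoc]),
              integral_const_mul, setIntegral_const]
            congr 1
            rw [smul_eq_mul, mul_comm]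
            congr 1
            rw [Measure.real, uIoc, Real.volume_Ioc, Real.dist_eq, max_sub_min_eq_abs',
              ENNReal.toReal_ofReal (abs_nonneg _)]
    refine (Finset.sum_le_sum step).trans ?_
    rw [Finset.sum_add_distrib, ← Finset.mul_sum, ← Finset.mul_sum]
    have hη0 : 0 < η := by positivity
    gcongr
    rw [← integral_biUnion_finset _ (fun i _ => measurableSet_uIoc) hE.2
      (fun i hi => hψii _ (hsub i hi))]
    refine (setIntegral_mono_set hψi (Eventually.of_forall fun t => hpos _) ?_).trans hψK
    exact LE.le.eventuallyLE (iUnion₂_subset hsub)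
  have hlim : Tendsto (fun k => ∑ i ∈ Finset.range n, dist (smean x (h k) (I i).1) (smean x (h k) (I i).2))
      atTop (𝓝 (∑ i ∈ Finset.range n, dist (x (I i).1) (x (I i).2))) := by
    apply tendsto_finsetSum
    intro i _
    exact (smean_tendsto x hx _ h hhpos hhlim).dist (smean_tendsto x hx _ h hhpos hhlim)
  have hle : ∑ i ∈ Finset.range n, dist (x (I i).1) (x (I i).2) ≤ η * K + c * δ := 
    le_of_tendsto_of_frequently hlim main
  have e1 : η * K ≤ ε / 4 := by
    rw [hη, div_mul_eq_mul_div, div_le_div_iff₀ (by positivity) (by positivity)]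
    nlinarith
  have e2 : c * δ ≤ ε / 4 := by
    rw [hδ, mul_div_assoc', div_le_div_iff₀ (by positivity) (by positivity)]
    nlinarith
  linarith

theorem action_le_liminf {d : ℕ} {T : ℝ} (hT : 0 ≤ T) {r C : ℝ} (hr : 1 < r) (hC : 0 < C)
    (L : Euc d → ℝ) (hLcont : Continuous L)
    (hLgrow : ∀ p : Euc d, 1 / (r * C) * ‖p‖ ^ r - C ≤ L p)
    (hpos : ∀ p, 0 ≤ L p + C) (γ : Traj d T) (h : ℕ → ℝ)
    (hhpos : ∀ n, 0 < h n) (hhlim : Tendsto h atTop (𝓝 0)) :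
    actionN L C γ ≤ liminf (fun n => stek hT L C (h n) γ) atTop := by
  by_cases htop : liminf (fun n => stek hT L C (h n) γ) atTop = ⊤
  · rw [htop]; exact le_top
  obtain ⟨K, hK⟩ : ∃ K : ℝ≥0, liminf (fun n => stek hT L C (h n) γ) atTop < K := by
    obtain ⟨K, hK⟩ := ENNReal.lt_iff_exists_nnreal_btwn.1 (lt_top_iff_ne_top.2 htop)
    exact ⟨K, hK.1⟩
  have hfreq := frequently_lt_of_liminf_lt (by isBoundedDefault) hK
  set x := fun t => evalAt hT t γ with hxdef
  have hx : Continuous x := evalAt_continuous_time hT γ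
  have hac : AbsolutelyContinuousOnInterval x 0 T :=
    ac_of_stek hT hr hC L hLcont hLgrow hpos γ h hhpos hhlim K K.2
      (hfreq.mono fun n hn => by simpa using hn.le)
  have haci : ∀ i, AbsolutelyContinuousOnInterval (fun t => x t i) 0 T := by
    intro i
    rw [absolutelyContinuousOnInterval_iff] at hac ⊢
    intro ε hε
    obtain ⟨δ, hδ, H⟩ := hac ε hε
    refine ⟨δ, hδ, fun E hE hs => lt_of_le_of_lt (Finset.sum_le_sum fun k _ => ?_) (H E hE hs)⟩
    rw [dist_eq_norm, dist_eq_norm]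
    exact PiLp.norm_apply_le (x (E.2 k).1 - x (E.2 k).2) i
  set g : ℝ → Euc d := fun t => WithLp.toLp 2 (fun i => deriv (fun t => x t i) t) with hg
  have hgi : ∀ i, IntervalIntegrable (fun t => g t i) volume 0 T := fun i =>
    (haci i).intervalIntegrable_deriv
  have hgint : IntervalIntegrable g volume 0 T := by
    rw [intervalIntegrable_iff_integrableOn_Ioc_of_le hT] at *
    have h1 : Integrable (fun t => fun i => g t i) (volume.restrict (Ioc 0 T)) :=
      Integrable.of_eval fun i => (intervalIntegrable_iff_integrableOn_Ioc_of_le hT).1 (hgi i)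
    exact (PiLp.continuousLinearEquiv 2 ℝ (fun _ : Fin d => ℝ)).symm.toContinuousLinearMap.integrable_comp h1
  have hderiv : ∀ᵐ t, t ∈ Ioc 0 T → HasDerivAt x (g t) t := by
    have : ∀ᵐ t, ∀ i, t ∈ uIcc 0 T → DifferentiableAt ℝ (fun t => x t i) t :=
      ae_all_iff.2 fun i => (haci i).ae_differentiableAt
    filter_upwards [this] with t ht htm
    have h1 : HasDerivAt (fun t => fun i => x t i) (fun i => g t i) t := by
      rw [hasDerivAt_pi]
      intro i
      refine (ht i ?_).hasDerivAt
      rw [uIcc_of_le hT]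
      exact Ioc_subset_Icc_self htm
    exact (PiLp.continuousLinearEquiv 2 ℝ (fun _ : Fin d => ℝ)).symm.toContinuousLinearMap.hasFDerivAt.comp_hasDerivAt t h1
  have hmem : (∫⁻ t in Ioc 0 T, ENNReal.ofReal (L (g t) + C)) ∈
    { a : ℝ≥0∞ | ∃ g : ℝ → Euc d, IntervalIntegrable g volume 0 T ∧
      (∀ s t : Set.Icc (0:ℝ) T, γ t - γ s = ∫ u in (s:ℝ)..(t:ℝ), g u) ∧
      a = ∫⁻ t in Set.Ioc (0:ℝ) T, ENNReal.ofReal (L (g t) + C) } := by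
    refine ⟨g, hgint, fun s t => ?_, rfl⟩
    have hss : uIcc (s:ℝ) t ⊆ uIcc 0 T := by
      rw [uIcc_of_le hT]
      exact uIcc_subset_Icc s.2 t.2
    have hgst : IntervalIntegrable g volume s t := hgint.mono_set hss
    ext i
    have e1 : (∫ u in (s:ℝ)..(t:ℝ), g u) i = ∫ u in (s:ℝ)..(t:ℝ), g u i :=
      ((EuclideanSpace.proj i : Euc d →L[ℝ] ℝ).intervalIntegral_comp_comm hgst).symm
    rw [e1]
    have e2 := ((haci i).mono hss).integral_deriv_eq_sub
    have e3 : ∀ s : Icc (0:ℝ) T, x s = γ s := fun s => by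
      simp [hxdef, evalAt]
    rw [← e3, ← e3]
    exact e2.symm
  refine (sInf_le hmem).trans ?_
  have hmeas : ∀ n, Measurable fun t => ENNReal.ofReal (L ((h n)⁻¹ • (x (t + h n) - x t)) + C) := by
    intro n
    apply Measurable.ennreal_ofReal
    exact (by fun_prop : Continuous fun t => L ((h n)⁻¹ • (x (t + h n) - x t)) + C).measurable
  refine le_trans ?_ (lintegral_liminf_le hmeas)
  apply lintegral_mono_ae
  rw [ae_restrict_iff' measurableSet_Ioc]
  filter_upwards [hderiv] with t ht htm
  have h2 := (ht htm).tendsto_slope_zero_right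
  have h3 : Tendsto h atTop (𝓝[>] 0) :=
    tendsto_nhdsWithin_iff.2 ⟨hhlim, Eventually.of_forall hhpos⟩
  have h4 := h2.comp h3
  have h5 : Tendsto (fun n => ENNReal.ofReal (L ((h n)⁻¹ • (x (t + h n) - x t)) + C)) atTop
      (𝓝 (ENNReal.ofReal (L (g t) + C))) := by
    apply ENNReal.tendsto_ofReal
    exact ((hLcont.tendsto _).comp h4).add_const C
  exact h5.liminf_eq.ge

theorem narrow_open {X : Type*} [TopologicalSpace X] [MeasurableSpace X] [OpensMeasurableSpace X]
    [HasOuterApproxClosed X]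
    (Q : ℕ → Measure X) (Qm : Measure X) (hQ : ∀ N, IsProbabilityMeasure (Q N))
    (hQm : IsProbabilityMeasure Qm) (h : NarrowTendsto Q Qm) (G : Set X) (hG : IsOpen G) :
    Qm G ≤ liminf (fun N => Q N G) atTop := by
  let P : ℕ → ProbabilityMeasure X := fun N => ⟨Q N, hQ N⟩
  let P0 : ProbabilityMeasure X := ⟨Qm, hQm⟩
  have : Tendsto P atTop (𝓝 P0) := by
    rw [ProbabilityMeasure.tendsto_iff_forall_integral_tendsto]
    exact h
  exact ProbabilityMeasure.le_liminf_measure_open_of_tendsto this hG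

theorem stek_eq {d : ℕ} {T : ℝ} (hT : 0 ≤ T) (L : Euc d → ℝ) (C : ℝ)
    (hLcont : Continuous L) (hpos : ∀ p, 0 ≤ L p + C) (h : ℝ) :
    ∃ s : Traj d T → ℝ, Continuous s ∧ 0 ≤ s ∧
      ∀ γ, stek hT L C h γ = ENNReal.ofReal (s γ) := by
  have hj : Continuous (fun p : Traj d T × ℝ =>
      L (h⁻¹ • (evalAt hT (p.2+h) p.1 - evalAt hT p.2 p.1)) + C) := by
    have h1 : Continuous (fun p : Traj d T × ℝ => evalAt hT (p.2+h) p.1) :=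
      (evalAt_continuous hT).comp (by fun_prop : Continuous fun p : Traj d T × ℝ => (p.2+h, p.1))
    have h2 : Continuous (fun p : Traj d T × ℝ => evalAt hT p.2 p.1) :=
      (evalAt_continuous hT).comp (by fun_prop : Continuous fun p : Traj d T × ℝ => (p.2, p.1))
    fun_prop
  refine ⟨fun γ => ∫ t in (0:ℝ)..T, (L (h⁻¹ • (evalAt hT (t+h) γ - evalAt hT t γ)) + C), ?_, ?_, ?_⟩
  · exact intervalIntegral.continuous_parametric_intervalIntegral_of_continuous' 
      (f := fun (γ : Traj d T) t => L (h⁻¹ • (evalAt hT (t+h) γ - evalAt hT t γ)) + C) hj 0 T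
  · intro γ
    exact intervalIntegral.integral_nonneg hT fun t _ => hpos _
  · intro γ
    have hc : Continuous fun t => L (h⁻¹ • (evalAt hT (t+h) γ - evalAt hT t γ)) + C :=
      hj.comp (by fun_prop : Continuous fun t : ℝ => (γ, t))
    simp only
    rw [intervalIntegral.integral_of_le hT, ofReal_integral_eq_lintegral_ofReal]
    · rfl
    · exact hc.integrableOn_Icc.mono_set Ioc_subset_Icc_self
    · exact Eventually.of_forall fun t => hpos _

theorem kin_liminf {d : ℕ} {T : ℝ} (hT : 0 ≤ T) {r C : ℝ} (hr : 1 < r) (hC : 0 < C)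
    (L : Euc d → ℝ) (hLconv : ConvexOn ℝ Set.univ L) (hLcont : Continuous L)
    (hLgrow : ∀ p : Euc d, 1 / (r * C) * ‖p‖ ^ r - C ≤ L p)
    (Q : ℕ → Measure (Traj d T)) (Qm : Measure (Traj d T))
    (hQ : ∀ N, IsProbabilityMeasure (Q N))
    (hQm : IsProbabilityMeasure Qm) (h : NarrowTendsto Q Qm) :
    ∫⁻ γ, actionN L C γ ∂Qm ≤ liminf (fun N => ∫⁻ γ, actionN L C γ ∂(Q N)) atTop := by
  have hpos : ∀ p, 0 ≤ L p + C := by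
    intro p
    have := hLgrow p
    have : 0 ≤ 1 / (r * C) * ‖p‖ ^ r := by positivity
    linarith
  set hh : ℕ → ℝ := fun n => 1 / ((n:ℝ) + 1) with hhdef
  have hhpos : ∀ n, 0 < hh n := fun n => by positivity
  have hhlim : Tendsto hh atTop (𝓝 0) := tendsto_one_div_add_atTop_nhds_zero_nat
  set ℓ := liminf (fun N => ∫⁻ γ, actionN L C γ ∂(Q N)) atTop with hℓ
  have step : ∀ n, ∫⁻ γ, stek hT L C (hh n) γ ∂Qm ≤ ℓ + ENNReal.ofReal (hh n * (L 0 + C)) := by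
    intro n
    obtain ⟨s, hs, hs0, hse⟩ := stek_eq hT L C hLcont hpos (hh n)
    have h1 := lintegral_le_liminf_lintegral_of_forall_isOpen_measure_le_liminf_measure
      hs hs0 (fun G hG => narrow_open Q Qm hQ hQm h G hG)
    simp_rw [← hse] at h1
    refine h1.trans ?_
    have h2 : ∀ N, ∫⁻ γ, stek hT L C (hh n) γ ∂(Q N) ≤
        (∫⁻ γ, actionN L C γ ∂(Q N)) + ENNReal.ofReal (hh n * (L 0 + C)) := by
      intro N
      refine (lintegral_mono fun γ => stek_le hT L C hLconv hLcont hpos _ (hhpos n) γ).trans ?_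
      rw [lintegral_add_right _ measurable_const]
      simp
    refine (liminf_le_liminf (Eventually.of_forall h2)).trans ?_
    rw [liminf_add_const _ _ _ (by isBoundedDefault) (by isBoundedDefault)]
  have hm : ∀ n, Measurable (stek hT L C (hh n) : Traj d T → ℝ≥0∞) := by
    intro n
    obtain ⟨s, hs, hs0, hse⟩ := stek_eq hT L C hLcont hpos (hh n)
    rw [funext hse]
    exact hs.measurable.ennreal_ofReal
  calc ∫⁻ γ, actionN L C γ ∂Qm ≤ ∫⁻ γ, liminf (fun n => stek hT L C (hh n) γ) atTop ∂Qm :=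
        lintegral_mono fun γ => action_le_liminf hT hr hC L hLcont hLgrow hpos γ hh hhpos hhlim
    _ ≤ liminf (fun n => ∫⁻ γ, stek hT L C (hh n) γ ∂Qm) atTop := lintegral_liminf_le hm
    _ ≤ liminf (fun n => ℓ + ENNReal.ofReal (hh n * (L 0 + C))) atTop :=
        liminf_le_liminf (Eventually.of_forall step)
    _ = ℓ := by
        apply Tendsto.liminf_eq
        have : Tendsto (fun n => hh n * (L 0 + C)) atTop (𝓝 0) := by
          simpa using hhlim.mul_const (L 0 + C)
        have := (ENNReal.tendsto_ofReal this).const_add ℓ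
        simpa using this

theorem f_bddBelow (f : ℝ → EReal) (hfbot : ∀ t, f t ≠ ⊥)
    (hflsc : LowerSemicontinuous f) (hfsl : SuperlinearE f) :
    ∃ c : ℝ, 0 ≤ c ∧ ∀ x, ((-c : ℝ) : EReal) ≤ f x := by
  obtain ⟨M, hM⟩ := hfsl 0
  set R := max M 0 with hR
  obtain ⟨x0, hx0, hmin⟩ := (hflsc.lowerSemicontinuousOn (Icc (-R) R)).exists_isMinOn
    ⟨0, by simp [hR]⟩ isCompact_Icc
  obtain ⟨m, hm⟩ : ∃ m : ℝ, (m : EReal) ≤ f x0 := by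
    by_cases h : f x0 = ⊤
    · exact ⟨0, by rw [h]; exact le_top⟩
    · exact ⟨(f x0).toReal, by rw [EReal.coe_toReal h (hfbot x0)]⟩
  refine ⟨max (-m) 0, le_max_right _ _, fun x => ?_⟩
  by_cases hx : x ∈ Icc (-R) R
  · refine le_trans ?_ (hm.trans (hmin hx))
    rw [EReal.coe_le_coe_iff]
    linarith [le_max_left (-m) 0]
  · have h1 : M ≤ |x| := by
      by_contra h2
      push Not at h2
      apply hx
      exact abs_le.1 (h2.le.trans (le_max_left _ _))
    refine le_trans ?_ (hM x h1)
    rw [EReal.coe_le_coe_iff]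
    simp

/-- the (real) epigraph -/
def epiE (f : ℝ → EReal) : Set (ℝ × ℝ) := {p | f p.1 ≤ (p.2 : EReal)}

/-- Legendre transform -/
def fstar (f : ℝ → EReal) (a : ℝ) : ℝ := sSup ((fun p : ℝ × ℝ => a * p.1 - p.2) '' epiE f)

theorem epiE_nonempty {f : ℝ → EReal} {s0 : ℝ} (hs0 : f s0 ≠ ⊤) : (epiE f).Nonempty :=
  ⟨(s0, (f s0).toReal), EReal.le_coe_toReal hs0⟩

theorem fstar_bdd (f : ℝ → EReal) (hfbot : ∀ t, f t ≠ ⊥)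
    (hflsc : LowerSemicontinuous f) (hfsl : SuperlinearE f) (a : ℝ) :
    BddAbove ((fun p : ℝ × ℝ => a * p.1 - p.2) '' epiE f) := by
  obtain ⟨c, hc0, hc⟩ := f_bddBelow f hfbot hflsc hfsl
  obtain ⟨M, hM⟩ := hfsl |a|
  refine ⟨|a| * |M| + c, ?_⟩
  rintro _ ⟨⟨x, y⟩, hxy, rfl⟩
  simp only [epiE, mem_ofPred_eq] at hxy
  simp only
  have h3 : a * x ≤ |a| * |x| := by rw [← abs_mul]; exact le_abs_self _
  by_cases h : M ≤ |x|
  · have h1 := (hM x h).trans hxy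
    rw [EReal.coe_le_coe_iff] at h1
    have : 0 ≤ |a| * |M| := by positivity
    linarith
  · have h1 := (hc x).trans hxy
    rw [EReal.coe_le_coe_iff] at h1
    push Not at h
    have : |a| * |x| ≤ |a| * |M| := 
      mul_le_mul_of_nonneg_left (h.le.trans (le_abs_self _)) (abs_nonneg a)
    linarith

theorem fstar_ge (f : ℝ → EReal) (hfbot : ∀ t, f t ≠ ⊥)
    (hflsc : LowerSemicontinuous f) (hfsl : SuperlinearE f) (a x y : ℝ) (h : f x ≤ y) :
    a * x - y ≤ fstar f a :=
  le_csSup (fstar_bdd f hfbot hflsc hfsl a) ⟨(x, y), h, rfl⟩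

theorem fstar_young (f : ℝ → EReal) (hfbot : ∀ t, f t ≠ ⊥)
    (hflsc : LowerSemicontinuous f) (hfsl : SuperlinearE f) (a x : ℝ) :
    ((a * x - fstar f a : ℝ) : EReal) ≤ f x := by
  by_cases h : f x = ⊤
  · rw [h]; exact le_top
  · have h1 := fstar_ge f hfbot hflsc hfsl a x (f x).toReal (EReal.le_coe_toReal h)
    rw [← EReal.coe_toReal h (hfbot x), EReal.coe_le_coe_iff]
    linarith

theorem fstar_le (f : ℝ → EReal) {s0 : ℝ} (hs0 : f s0 ≠ ⊤) (a b : ℝ)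
    (h : ∀ x y : ℝ, f x ≤ y → a * x - y ≤ b) : fstar f a ≤ b := by
  apply csSup_le ((epiE_nonempty hs0).image _)
  rintro _ ⟨⟨x, y⟩, hxy, rfl⟩
  exact h x y hxy

theorem fstar_convex (f : ℝ → EReal) (hfbot : ∀ t, f t ≠ ⊥)
    (hflsc : LowerSemicontinuous f) (hfsl : SuperlinearE f) {s0 : ℝ} (hs0 : f s0 ≠ ⊤) :
    ConvexOn ℝ univ (fstar f) := by
  refine ⟨convex_univ, ?_⟩
  intro a _ b _ u v hu hv huv
  apply fstar_le f hs0
  intro x y hxy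
  have h1 := fstar_ge f hfbot hflsc hfsl a x y hxy
  have h2 := fstar_ge f hfbot hflsc hfsl b x y hxy
  simp only [smul_eq_mul]
  calc (u * a + v * b) * x - y = u * (a * x - y) + v * (b * x - y) := by
        have : v = 1 - u := by linarith
        subst this; ring
    _ ≤ _ := by gcongr

theorem fstar_continuous (f : ℝ → EReal) (hfbot : ∀ t, f t ≠ ⊥)
    (hflsc : LowerSemicontinuous f) (hfsl : SuperlinearE f) {s0 : ℝ} (hs0 : f s0 ≠ ⊤) :
    Continuous (fstar f) :=
  (fstar_convex f hfbot hflsc hfsl hs0).locallyLipschitz.continuous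

theorem fstar_lip (f : ℝ → EReal) (hfbot : ∀ t, f t ≠ ⊥)
    (hflsc : LowerSemicontinuous f) (hfsl : SuperlinearE f) {s0 : ℝ} (hs0 : f s0 ≠ ⊤) (R : ℝ) :
    ∃ K : ℝ≥0, LipschitzOnWith K (fstar f) (Icc (-R) R) :=
  LocallyLipschitzOn.exists_lipschitzOnWith_of_compact isCompact_Icc
    ((fstar_convex f hfbot hflsc hfsl hs0).locallyLipschitz.locallyLipschitzOn)

theorem epiE_convex (f : ℝ → EReal) (hfconv : ConvexE f) : Convex ℝ (epiE f) := by
  rintro ⟨x1, y1⟩ h1 ⟨x2, y2⟩ h2 u v hu hv huv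
  simp only [epiE, mem_ofPred_eq] at h1 h2
  simp only [epiE, mem_ofPred_eq, Prod.smul_mk, Prod.mk_add_mk, smul_eq_mul]
  have hv' : v = 1 - u := by linarith
  subst hv'
  refine (hfconv x1 x2 u ⟨hu, by linarith⟩).trans ?_
  push_cast
  gcongr
  exact_mod_cast hv

theorem epiE_closed (f : ℝ → EReal) (hflsc : LowerSemicontinuous f) : IsClosed (epiE f) := by
  have := hflsc.isClosed_epigraph
  exact this.preimage (Continuous.prodMk continuous_fst (continuous_coe_real_ereal.comp continuous_snd))

theorem fstar_biconj (f : ℝ → EReal) (hfbot : ∀ t, f t ≠ ⊥) (hfconv : ConvexE f)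
    (hflsc : LowerSemicontinuous f) (hfsl : SuperlinearE f) {s0 : ℝ} (hs0 : f s0 ≠ ⊤)
    (s M : ℝ) (hM : (M : EReal) < f s) : ∃ a : ℝ, M < a * s - fstar f a := by
  obtain ⟨c, hc0, hc⟩ := f_bddBelow f hfbot hflsc hfsl
  obtain ⟨ℓ, u, h1, h2⟩ := geometric_hahn_banach_closed_point (epiE_convex f hfconv)
    (epiE_closed f hflsc) (x := (s, M)) (by simpa [epiE] using hM)
  set p := ℓ (1, 0) with hp
  set q := ℓ (0, 1) with hq
  have hℓ : ∀ x y : ℝ, ℓ (x, y) = p * x + q * y := by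
    intro x y
    have : ((x, y) : ℝ × ℝ) = x • ((1:ℝ), (0:ℝ)) + y • ((0:ℝ), (1:ℝ)) := by simp
    rw [this, map_add, map_smul, map_smul, smul_eq_mul, smul_eq_mul, mul_comm x, mul_comm y]
  rw [hℓ] at h2
  have h1' : ∀ x y : ℝ, f x ≤ y → p * x + q * y < u := by
    intro x y h
    rw [← hℓ]; exact h1 _ h
  have hq0 : q ≤ 0 := by
    by_contra hq1
    push Not at hq1
    set y0 := (f s0).toReal
    have hy0 : f s0 ≤ y0 := EReal.le_coe_toReal hs0
    set k := max 0 ((u - p * s0 - q * y0) / q)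
    have h3 := h1' s0 (y0 + k) (hy0.trans (by
      rw [EReal.coe_le_coe_iff]; linarith [le_max_left 0 ((u - p * s0 - q * y0) / q)]))
    have h4 : (u - p * s0 - q * y0) / q ≤ k := le_max_right _ _
    rw [div_le_iff₀ hq1] at h4
    linarith
  rcases hq0.lt_or_eq with hq1 | hq1
  · refine ⟨p / (-q), ?_⟩
    have h3 : fstar f (p / (-q)) ≤ u / (-q) := by
      apply fstar_le f hs0
      intro x y h
      have := h1' x y h
      rw [le_div_iff₀ (by linarith)]
      have e : (p / -q * x - y) * -q = p * x + q * y := by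
        have : q ≠ 0 := hq1.ne
        field_simp
        ring
      rw [e]; exact this.le
    have h4 : u / (-q) < p / (-q) * s - M := by
      rw [div_lt_iff₀ (by linarith)]
      have e : (p / -q * s - M) * -q = p * s + q * M := by
        have : q ≠ 0 := hq1.ne
        field_simp
        ring
      rw [e]; exact h2
    linarith
  · rw [hq1] at h2 h1'
    simp only [zero_mul, add_zero] at h2 h1'
    set k := (|M| + c + 1) / (p * s - u) with hk
    have hpos : 0 < p * s - u := by linarith
    have hk0 : 0 ≤ k := by positivity
    refine ⟨k * p, ?_⟩
    have h3 : fstar f (k * p) ≤ k * u + c := by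
      apply fstar_le f hs0
      intro x y h
      have h4 := h1' x y h
      have h5 := (hc x).trans h
      rw [EReal.coe_le_coe_iff] at h5
      have : k * (p * x) ≤ k * u := by gcongr
      linarith
    have h4 : k * (p * s - u) = |M| + c + 1 := by rw [hk]; field_simp
    have := le_abs_self M
    nlinarith

theorem fstar_biconj_dense (f : ℝ → EReal) (hfbot : ∀ t, f t ≠ ⊥) (hfconv : ConvexE f)
    (hflsc : LowerSemicontinuous f) (hfsl : SuperlinearE f) {s0 : ℝ} (hs0 : f s0 ≠ ⊤)
    (s M : ℝ) (hM : (M : EReal) < f s) :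
    ∃ n : ℕ, M < TopologicalSpace.denseSeq ℝ n * s - fstar f (TopologicalSpace.denseSeq ℝ n) := by
  obtain ⟨a, ha⟩ := fstar_biconj f hfbot hfconv hflsc hfsl hs0 s M hM
  have hcont : Continuous fun a => a * s - fstar f a := by
    have := fstar_continuous f hfbot hflsc hfsl hs0
    fun_prop
  have hopen : IsOpen {a | M < a * s - fstar f a} := isOpen_lt continuous_const hcont
  obtain ⟨n, hn⟩ := (TopologicalSpace.denseRange_denseSeq ℝ).exists_mem_open hopen ⟨a, ha⟩
  exact ⟨n, hn⟩

/-- near-optimal slopes -/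
def slopeSel (f : ℝ → EReal) : ℕ → ℝ → ℝ
  | 0, _ => 0
  | n+1, s => if slopeSel f n s * s - fstar f (slopeSel f n s) <
      TopologicalSpace.denseSeq ℝ n * s - fstar f (TopologicalSpace.denseSeq ℝ n)
      then TopologicalSpace.denseSeq ℝ n else slopeSel f n s

theorem slopeSel_measurable (f : ℝ → EReal) (hc : Continuous (fstar f)) (n : ℕ) :
    Measurable (slopeSel f n) := by
  induction n with
  | zero => exact measurable_const
  | succ n ih =>
    have hm := hc.measurable
    have : slopeSel f (n+1) = fun s => if slopeSel f n s * s - fstar f (slopeSel f n s) <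
      TopologicalSpace.denseSeq ℝ n * s - fstar f (TopologicalSpace.denseSeq ℝ n)
      then TopologicalSpace.denseSeq ℝ n else slopeSel f n s := rfl
    rw [this]
    apply Measurable.ite
    · apply measurableSet_lt
      · exact (ih.mul measurable_id).sub (hm.comp ih)
      · fun_prop
    · exact measurable_const
    · exact ih

theorem slopeSel_bdd (f : ℝ → EReal) (n : ℕ) : ∃ R : ℝ, 0 ≤ R ∧ ∀ s, |slopeSel f n s| ≤ R := by
  induction n with
  | zero => exact ⟨0, le_rfl, fun s => by simp [slopeSel]⟩
  | succ n ih =>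
    obtain ⟨R, hR, h⟩ := ih
    refine ⟨max R |TopologicalSpace.denseSeq ℝ n|, hR.trans (le_max_left _ _), fun s => ?_⟩
    unfold slopeSel
    split_ifs
    · exact le_max_right _ _
    · exact (h s).trans (le_max_left _ _)

/-- lower approximations of `f` -/
def fapp (f : ℝ → EReal) (n : ℕ) (s : ℝ) : ℝ := slopeSel f n s * s - fstar f (slopeSel f n s)

theorem fapp_succ (f : ℝ → EReal) (n : ℕ) (s : ℝ) : fapp f n s ≤ fapp f (n+1) s ∧
    TopologicalSpace.denseSeq ℝ n * s - fstar f (TopologicalSpace.denseSeq ℝ n) ≤ fapp f (n+1) s := by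
  have : slopeSel f (n+1) s = if slopeSel f n s * s - fstar f (slopeSel f n s) <
      TopologicalSpace.denseSeq ℝ n * s - fstar f (TopologicalSpace.denseSeq ℝ n)
      then TopologicalSpace.denseSeq ℝ n else slopeSel f n s := rfl
  unfold fapp
  rw [this]
  split_ifs with h
  · exact ⟨h.le, le_rfl⟩
  · exact ⟨le_rfl, not_lt.1 h⟩

theorem fapp_mono (f : ℝ → EReal) (s : ℝ) : Monotone (fun n => fapp f n s) :=
  monotone_nat_of_le_succ fun n => (fapp_succ f n s).1

theorem fapp_zero (f : ℝ → EReal) (s : ℝ) : fapp f 0 s = - fstar f 0 := by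
  simp [fapp, slopeSel]

theorem fapp_sup (f : ℝ → EReal) (hfbot : ∀ t, f t ≠ ⊥) (hfconv : ConvexE f)
    (hflsc : LowerSemicontinuous f) (hfsl : SuperlinearE f) {s0 : ℝ} (hs0 : f s0 ≠ ⊤) (s : ℝ) :
    f s ≤ ⨆ n, (fapp f n s : EReal) := by
  by_contra hcon
  obtain ⟨M, hM1, hM⟩ := EReal.lt_iff_exists_real_btwn.1 (not_le.1 hcon)
  refine absurd hM1 (not_lt.2 ?_)
  obtain ⟨n, hn⟩ := fstar_biconj_dense f hfbot hfconv hflsc hfsl hs0 s M hM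
  refine le_trans ?_ (le_iSup (fun n => (fapp f n s : EReal)) (n+1))
  rw [EReal.coe_le_coe_iff]
  exact hn.le.trans (fapp_succ f n s).2

theorem ERtoENN_eq (x : EReal) : ERtoENN x = x.toENNReal := by
  unfold ERtoENN EReal.toENNReal
  split_ifs <;> rfl

theorem ERtoENN_mono {x y : EReal} (h : x ≤ y) : ERtoENN x ≤ ERtoENN y := by
  rw [ERtoENN_eq, ERtoENN_eq]; exact EReal.toENNReal_le_toENNReal h

theorem ERtoENN_coe (x : ℝ) : ERtoENN (x : EReal) = ENNReal.ofReal x := by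
  simp [ERtoENN]

theorem eintegral_mono {α : Type*} [MeasurableSpace α] {μ : Measure α} {g h : α → EReal}
    (hgh : ∀ᵐ a ∂μ, g a ≤ h a) : eintegral μ g ≤ eintegral μ h := by
  unfold eintegral
  apply EReal.sub_le_sub
  · rw [EReal.coe_ennreal_le_coe_ennreal_iff]
    apply lintegral_mono_ae
    filter_upwards [hgh] with a ha using ERtoENN_mono ha
  · rw [EReal.coe_ennreal_le_coe_ennreal_iff]
    apply lintegral_mono_ae
    filter_upwards [hgh] with a ha using ERtoENN_mono (EReal.neg_le_neg_iff.2 ha)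

theorem eintegral_congr {α : Type*} [MeasurableSpace α] {μ : Measure α} {g h : α → EReal}
    (hgh : ∀ᵐ a ∂μ, g a = h a) : eintegral μ g = eintegral μ h :=
  le_antisymm (eintegral_mono (hgh.mono fun _ h => h.le)) (eintegral_mono (hgh.mono fun _ h => h.ge))

theorem eintegral_real {α : Type*} [MeasurableSpace α] {μ : Measure α} {h : α → ℝ}
    (hh : Integrable h μ) : eintegral μ (fun a => (h a : EReal)) = ((∫ a, h a ∂μ : ℝ) : EReal) := by
  unfold eintegral
  have e1 : ∀ a, ERtoENN (h a : EReal) = ENNReal.ofReal (h a) := fun a => ERtoENN_coe _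
  have e2 : ∀ a, ERtoENN (-(h a : EReal)) = ENNReal.ofReal (-h a) := fun a => by
    rw [← EReal.coe_neg, ERtoENN_coe]
  simp only [e1, e2]
  rw [integral_eq_lintegral_pos_part_sub_lintegral_neg_part hh]
  have f1 : ∫⁻ a, ENNReal.ofReal (h a) ∂μ ≠ ⊤ := hh.lintegral_lt_top.ne
  have f2 : ∫⁻ a, ENNReal.ofReal (-h a) ∂μ ≠ ⊤ := hh.neg.lintegral_lt_top.ne
  rw [EReal.coe_sub, EReal.coe_ennreal_toReal f1, EReal.coe_ennreal_toReal f2]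

theorem eintegral_iSup_le {α : Type*} [MeasurableSpace α] {μ : Measure α} {h : ℕ → α → ℝ}
    (hh : ∀ n, Integrable (h n) μ) (hmono : ∀ a, Monotone fun n => h n a) {g : α → EReal}
    (hg : ∀ᵐ a ∂μ, g a ≤ ⨆ n, (h n a : EReal)) {S : EReal}
    (hS : ∀ n, ((∫ a, h n a ∂μ : ℝ) : EReal) ≤ S) : eintegral μ g ≤ S := by
  induction S with
  | bot => exact absurd (hS 0) (by simp)
  | top => exact le_top
  | coe S =>
    simp only [EReal.coe_le_coe_iff] at hS
    set H : α → ℝ≥0∞ := fun a => ⨆ n, ENNReal.ofReal (h n a - h 0 a) with hH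
    have hHle : ∀ n a, ENNReal.ofReal (h n a - h 0 a) ≤ H a := fun n a =>
      le_iSup (fun n => ENNReal.ofReal (h n a - h 0 a)) n
    have hmeas : ∀ n, AEMeasurable (fun a => ENNReal.ofReal (h n a - h 0 a)) μ := fun n =>
      ((hh n).sub (hh 0)).aemeasurable.ennreal_ofReal
    have hHm : AEMeasurable H μ := AEMeasurable.iSup hmeas
    have h1 : ∫⁻ a, H a ∂μ ≤ ENNReal.ofReal (S - ∫ a, h 0 a ∂μ) := by
      rw [hH, lintegral_iSup' hmeas]
      · apply iSup_le
        intro n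
        have e0 := ofReal_integral_eq_lintegral_ofReal ((hh n).sub (hh 0)) ?_
        · simp only [Pi.sub_apply] at e0
          rw [← e0]
          apply ENNReal.ofReal_le_ofReal
          rw [integral_sub (hh n) (hh 0)]
          linarith [hS n]
        · filter_upwards with a
          simp only [Pi.zero_apply, Pi.sub_apply, sub_nonneg]
          exact hmono a (Nat.zero_le n)
      · filter_upwards with a
        intro m n hmn
        apply ENNReal.ofReal_le_ofReal
        have := hmono a hmn
        simp only at this
        linarith
    have h2 : ∫⁻ a, H a ∂μ ≠ ⊤ := (h1.trans_lt ENNReal.ofReal_lt_top).ne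
    have h3 : ∀ᵐ a ∂μ, H a < ⊤ := ae_lt_top' hHm h2
    have hHint : Integrable (fun a => (H a).toReal) μ := integrable_toReal_of_lintegral_ne_top hHm h2
    have h4 : eintegral μ g ≤ eintegral μ (fun a => ((h 0 a + (H a).toReal : ℝ) : EReal)) := by
      apply eintegral_mono
      filter_upwards [hg, h3] with a ha hfin
      refine ha.trans (iSup_le fun n => ?_)
      rw [EReal.coe_le_coe_iff]
      have := ENNReal.toReal_mono hfin.ne (hHle n a)
      have h5 : h n a - h 0 a ≤ (ENNReal.ofReal (h n a - h 0 a)).toReal := by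
        rw [ENNReal.toReal_ofReal']; exact le_max_left _ _
      linarith
    refine h4.trans ?_
    have e0 := eintegral_real ((hh 0).add hHint)
    simp only [Pi.add_apply] at e0
    rw [e0, EReal.coe_le_coe_iff, integral_add (hh 0) hHint,
      integral_toReal hHm h3]
    have h6 : 0 ≤ S - ∫ a, h 0 a ∂μ := by linarith [hS 0]
    have := ENNReal.toReal_mono ENNReal.ofReal_ne_top h1
    rw [ENNReal.toReal_ofReal h6] at this
    linarith

theorem eintegral_finite {α : Type*} [MeasurableSpace α] {μ : Measure α} [IsFiniteMeasure μ]
    {g : α → EReal} (hg : AEMeasurable g μ) {c : ℝ} (hc : ∀ a, ((-c : ℝ) : EReal) ≤ g a)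
    (hfin : eintegral μ g ≠ ⊤) :
    (∀ᵐ a ∂μ, g a = ((g a).toReal : EReal)) ∧ Integrable (fun a => (g a).toReal) μ ∧
      eintegral μ g = ((∫ a, (g a).toReal ∂μ : ℝ) : EReal) := by
  have hneg : ∫⁻ a, ERtoENN (-(g a)) ∂μ ≠ ⊤ := by
    apply ne_top_of_le_ne_top (b := ∫⁻ a, ENNReal.ofReal c ∂μ)
    · rw [lintegral_const]; exact ENNReal.mul_ne_top ENNReal.ofReal_ne_top (measure_ne_top _ _)
    · apply lintegral_mono
      intro a
      rw [← ERtoENN_coe]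
      apply ERtoENN_mono
      rw [EReal.neg_le]
      simpa using hc a
  have hpos : ∫⁻ a, ERtoENN (g a) ∂μ ≠ ⊤ := by
    intro h
    apply hfin
    unfold eintegral
    rw [h, ← EReal.coe_ennreal_toReal hneg]
    simp
  have hm : AEMeasurable (fun a => ERtoENN (g a)) μ := by
    simp only [ERtoENN_eq]
    exact hg.ereal_toENNReal
  have hae : ∀ᵐ a ∂μ, g a = ((g a).toReal : EReal) := by
    filter_upwards [ae_lt_top' hm hpos] with a ha
    rw [EReal.coe_toReal]
    · intro h; rw [h] at ha; simp [ERtoENN] at ha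
    · intro h; have := hc a; rw [h] at this; simp at this
  have hIntg : Integrable (fun a => (g a).toReal) μ := by
    have hm2 : AEMeasurable (fun a => (g a).toReal) μ := measurable_ereal_toReal.comp_aemeasurable hg
    refine ⟨hm2.aestronglyMeasurable, ?_⟩
    unfold HasFiniteIntegral
    refine lt_of_le_of_lt (b := ∫⁻ a, (ERtoENN (g a) + ENNReal.ofReal c) ∂μ) ?_ ?_
    · apply lintegral_mono_ae
      filter_upwards [hae] with a ha
      have h1 := hc a
      rw [ha, EReal.coe_le_coe_iff] at h1
      conv_rhs => rw [ha, ERtoENN_coe]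
      rw [Real.enorm_eq_ofReal_abs]
      refine le_trans ?_ (b := ENNReal.ofReal (max (g a).toReal 0 + max c 0)) ?_
      · apply ENNReal.ofReal_le_ofReal
        rw [abs_le]
        constructor
        · linarith [le_max_right (g a).toReal 0, le_max_left c 0]
        · linarith [le_max_left (g a).toReal 0, le_max_right c 0]
      · rw [ENNReal.ofReal_add (le_max_right _ _) (le_max_right _ _)]
        simp [ENNReal.ofReal_max]
    · rw [lintegral_add_right _ measurable_const, lintegral_const]
      exact ENNReal.add_lt_top.2 ⟨hpos.lt_top, ENNReal.mul_lt_top ENNReal.ofReal_lt_top (measure_lt_top _ _)⟩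
  refine ⟨hae, hIntg, ?_⟩
  rw [← eintegral_real hIntg]
  exact eintegral_congr hae

theorem intFE_lower {d : ℕ} (Ω : Set (Euc d)) (hΩc : IsCompact Ω) (hΩmeas : MeasurableSet Ω)
    (f : ℝ → EReal) (hfbot : ∀ t, f t ≠ ⊥)
    (hflsc : LowerSemicontinuous f) (hfsl : SuperlinearE f) {s0 : ℝ} (hs0 : f s0 ≠ ⊤)
    (ρ : Measure (Euc d)) [IsProbabilityMeasure ρ] (hρ : ρ Ωᶜ = 0)
    (φ : Euc d → ℝ) (hφ : Continuous φ) (hφc : HasCompactSupport φ) :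
    ((∫ x, φ x ∂ρ - ∫ x in Ω, fstar f (φ x) : ℝ) : EReal) ≤ intFE Ω f ρ := by
  unfold intFE
  split_ifs with hac
  swap
  · exact le_top
  have hstar := fstar_continuous f hfbot hflsc hfsl hs0
  have : IsFiniteMeasure (volume.restrict Ω) := ⟨by simpa using hΩc.measure_lt_top⟩
  have hφi : Integrable φ ρ := hφ.integrable_of_hasCompactSupport hφc
  have i1 : Integrable (fun x => (ρ.rnDeriv volume x).toReal * φ x) (volume.restrict Ω) := by
    have := (integrable_rnDeriv_smul_iff (f := φ) hac).2 hφi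
    exact this.integrableOn
  have i2 : Integrable (fun x => fstar f (φ x)) (volume.restrict Ω) :=
    (hstar.comp hφ).continuousOn.integrableOn_compact hΩc
  have e1 : ∫ x, φ x ∂ρ = ∫ x in Ω, (ρ.rnDeriv volume x).toReal * φ x := by
    have := setIntegral_rnDeriv_smul (f := φ) hac hΩmeas
    simp only [smul_eq_mul] at this
    rw [this, Measure.restrict_eq_self_of_ae_mem]
    rw [ae_iff]; exact hρ
  have e0 := eintegral_real (i1.sub i2)
  simp only [Pi.sub_apply] at e0
  rw [e1, ← integral_sub i1 i2, ← e0]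
  apply eintegral_mono
  filter_upwards with x
  have := fstar_young f hfbot hflsc hfsl (φ x) (ρ.rnDeriv volume x).toReal
  rwa [mul_comm] at this

theorem approx_bdd {d : ℕ} (ν : Measure (Euc d)) [IsFiniteMeasure ν] (φ0 : Euc d → ℝ)
    (hm : Measurable φ0) {R : ℝ} (hR : 0 ≤ R) (hb : ∀ x, |φ0 x| ≤ R) {η : ℝ} (hη : 0 < η) :
    ∃ φ : Euc d → ℝ, Continuous φ ∧ HasCompactSupport φ ∧ (∀ x, |φ x| ≤ R) ∧
      ∫ x, |φ0 x - φ x| ∂ν ≤ η := by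
  have hL : MemLp φ0 1 ν := by
    rw [memLp_one_iff_integrable]
    exact Integrable.of_bound hm.aestronglyMeasurable R (by filter_upwards with x; exact hb x)
  obtain ⟨g, hg1, hg2, hg3, hg4⟩ := hL.exists_hasCompactSupport_eLpNorm_sub_le (by simp)
    (ε := ENNReal.ofReal η) (by simpa using hη)
  set cl : ℝ → ℝ := fun y => max (-R) (min R y) with hcl
  have hcl0 : cl 0 = 0 := by simp [hcl, hR]
  have hcont : Continuous (cl ∘ g) := by
    have : Continuous cl := by fun_prop
    exact this.comp hg3
  have hbd : ∀ x, |cl (g x)| ≤ R := by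
    intro x
    rw [abs_le]
    exact ⟨le_max_left _ _, max_le (by linarith) (min_le_left _ _)⟩
  refine ⟨cl ∘ g, hcont, hg1.comp_left hcl0, hbd, ?_⟩
  have hsub : MemLp (φ0 - g) 1 ν := hL.sub hg4
  rw [memLp_one_iff_integrable] at hsub
  have h1 : ∫ x, |φ0 x - (cl ∘ g) x| ∂ν ≤ ∫ x, |φ0 x - g x| ∂ν := by
    apply integral_mono_of_nonneg
    · filter_upwards with x; positivity
    · exact hsub.abs
    · filter_upwards with x
      simp only [Function.comp, hcl]
      have := abs_le.1 (hb x)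
      rcases max_cases (-R) (min R (g x)) with h | h <;> rcases min_cases R (g x) with h' | h' <;>
        rcases abs_cases (φ0 x - g x) with h3 | h3 <;> rw [abs_le] <;> constructor <;> linarith
  refine h1.trans ?_
  rw [eLpNorm_one_eq_lintegral_enorm] at hg2
  have h2 := hsub.abs
  have : ∫ x, |φ0 x - g x| ∂ν = (∫⁻ x, ‖(φ0 - g) x‖ₑ ∂ν).toReal := by
    rw [← integral_norm_eq_lintegral_enorm hsub.1]
    rfl
  rw [this]
  exact ENNReal.toReal_le_of_le_ofReal hη.le hg2

theorem dual_bdd {d : ℕ} (Ω : Set (Euc d)) (hΩc : IsCompact Ω) 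
    (f : ℝ → EReal) (hfbot : ∀ t, f t ≠ ⊥)
    (hflsc : LowerSemicontinuous f) (hfsl : SuperlinearE f) {s0 : ℝ} (hs0 : f s0 ≠ ⊤)
    (μ : Measure (Euc d)) [IsProbabilityMeasure μ] (S : EReal)
    (hS : ∀ φ : Euc d → ℝ, Continuous φ → HasCompactSupport φ →
      ((∫ x, φ x ∂μ - ∫ x in Ω, fstar f (φ x) : ℝ) : EReal) ≤ S)
    (φ0 : Euc d → ℝ) (hm : Measurable φ0) {R : ℝ} (hR : 0 ≤ R) (hb : ∀ x, |φ0 x| ≤ R) :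
    ((∫ x, φ0 x ∂μ - ∫ x in Ω, fstar f (φ0 x) : ℝ) : EReal) ≤ S := by
  have hstar := fstar_continuous f hfbot hflsc hfsl hs0
  have : IsFiniteMeasure (volume.restrict Ω) := ⟨by simpa using hΩc.measure_lt_top⟩
  induction S with
  | top => exact le_top
  | bot => exact absurd (hS 0 continuous_const HasCompactSupport.zero) (not_le.2 (EReal.bot_lt_coe _))
  | coe S =>
    simp only [EReal.coe_le_coe_iff] at hS ⊢
    obtain ⟨K, hK⟩ := fstar_lip f hfbot hflsc hfsl hs0 R
    refine le_of_forall_pos_le_add fun η hη => ?_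
    obtain ⟨φ, hφ1, hφ2, hφ3, hφ4⟩ := approx_bdd (μ + volume.restrict Ω) φ0 hm hR hb
      (η := η / (1 + K)) (by positivity)
    have h1 := hS φ hφ1 hφ2
    have iφ0 : ∀ ν : Measure (Euc d), IsFiniteMeasure ν → Integrable φ0 ν := fun ν _ =>
      Integrable.of_bound hm.aestronglyMeasurable R (by filter_upwards with x; exact hb x)
    have iφ : ∀ ν : Measure (Euc d), IsFiniteMeasure ν → Integrable φ ν := fun ν _ =>
      Integrable.of_bound hφ1.measurable.aestronglyMeasurable R (by filter_upwards with x; exact hφ3 x)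
    have id : ∀ ν : Measure (Euc d), IsFiniteMeasure ν → Integrable (fun x => |φ0 x - φ x|) ν :=
      fun ν h => ((iφ0 ν h).sub (iφ ν h)).abs
    rw [integral_add_measure (id _ inferInstance) (id _ inferInstance)] at hφ4
    obtain ⟨B, hB⟩ : ∃ B, ∀ y ∈ Icc (-R) R, ‖fstar f y‖ ≤ B :=
      isCompact_Icc.exists_bound_of_continuousOn hstar.continuousOn
    have j0 : Integrable (fun x => fstar f (φ0 x)) (volume.restrict Ω) :=
      Integrable.of_bound (hstar.measurable.comp hm).aestronglyMeasurable B
        (by filter_upwards with x; exact hB _ (abs_le.1 (hb x)))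
    have j : Integrable (fun x => fstar f (φ x)) (volume.restrict Ω) :=
      Integrable.of_bound (hstar.measurable.comp hφ1.measurable).aestronglyMeasurable B
        (by filter_upwards with x; exact hB _ (abs_le.1 (hφ3 x)))
    have h2 : ∫ x, φ0 x ∂μ - ∫ x, φ x ∂μ ≤ ∫ x, |φ0 x - φ x| ∂μ := by
      rw [← integral_sub (iφ0 _ inferInstance) (iφ _ inferInstance)]
      exact integral_mono ((iφ0 _ inferInstance).sub (iφ _ inferInstance)) (id _ inferInstance)
        (fun x => le_abs_self _)
    have h3 : (∫ x in Ω, fstar f (φ x)) - ∫ x in Ω, fstar f (φ0 x) ≤ K * ∫ x in Ω, |φ0 x - φ x| := by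
      rw [← integral_sub j j0, ← integral_const_mul]
      refine integral_mono (j.sub j0) ((id _ inferInstance).const_mul _) (fun x => ?_)
      have := hK.dist_le_mul _ (abs_le.1 (hφ3 x)) _ (abs_le.1 (hb x))
      rw [Real.dist_eq, Real.dist_eq, abs_sub_comm (φ x)] at this
      exact (le_abs_self _).trans this
    have p1 : 0 ≤ ∫ x, |φ0 x - φ x| ∂μ := integral_nonneg fun x => abs_nonneg _
    have p2 : 0 ≤ ∫ x in Ω, |φ0 x - φ x| := integral_nonneg fun x => abs_nonneg _
    rw [le_div_iff₀ (by positivity)] at hφ4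
    have : (0:ℝ) ≤ K := K.2
    nlinarith [mul_nonneg this p1]

theorem intFE_dual {d : ℕ} (Ω : Set (Euc d)) (hΩc : IsCompact Ω) (hΩmeas : MeasurableSet Ω)
    (f : ℝ → EReal) (hfbot : ∀ t, f t ≠ ⊥) (hfconv : ConvexE f)
    (hflsc : LowerSemicontinuous f) (hfsl : SuperlinearE f) {s0 : ℝ} (hs0 : f s0 ≠ ⊤)
    (μ : Measure (Euc d)) [IsProbabilityMeasure μ] (S : EReal)
    (hS : ∀ φ : Euc d → ℝ, Continuous φ → HasCompactSupport φ →
      ((∫ x, φ x ∂μ - ∫ x in Ω, fstar f (φ x) : ℝ) : EReal) ≤ S) :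
    intFE Ω f μ ≤ S := by
  have hstar := fstar_continuous f hfbot hflsc hfsl hs0
  have : IsFiniteMeasure (volume.restrict Ω) := ⟨by simpa using hΩc.measure_lt_top⟩
  have key := dual_bdd Ω hΩc f hfbot hflsc hfsl hs0 μ S hS
  unfold intFE
  split_ifs with hac
  · set u : Euc d → ℝ := fun x => (μ.rnDeriv volume x).toReal with hu
    have hum : Measurable u := (Measure.measurable_rnDeriv _ _).ennreal_toReal
    have hui : Integrable u volume := Measure.integrable_toReal_rnDeriv
    have hsm := slopeSel_measurable f hstar
    have main : ∀ n, Integrable (fun x => fapp f n (u x)) (volume.restrict Ω) ∧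
        ((∫ x in Ω, fapp f n (u x) : ℝ) : EReal) ≤ S := by
      intro n
      obtain ⟨R, hR, hb⟩ := slopeSel_bdd f n
      obtain ⟨B, hB⟩ : ∃ B, ∀ y ∈ Icc (-R) R, ‖fstar f y‖ ≤ B :=
        isCompact_Icc.exists_bound_of_continuousOn hstar.continuousOn
      have m1 : Measurable fun x => slopeSel f n (u x) := (hsm n).comp hum
      have i1 : Integrable (fun x => u x * slopeSel f n (u x)) (volume.restrict Ω) := by
        have := hui.integrableOn (s := Ω)
        exact this.mul_bdd (c := R) m1.aestronglyMeasurable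
          (by filter_upwards with x; exact hb _)
      have i2 : Integrable (fun x => fstar f (slopeSel f n (u x))) (volume.restrict Ω) :=
        Integrable.of_bound (hstar.measurable.comp m1).aestronglyMeasurable B
          (by filter_upwards with x; exact hB _ (abs_le.1 (hb _)))
      have e : (fun x => fapp f n (u x)) =
          fun x => u x * slopeSel f n (u x) - fstar f (slopeSel f n (u x)) := by
        funext x; unfold fapp; ring
      rw [e]
      refine ⟨i1.sub i2, ?_⟩
      rw [integral_sub i1 i2]
      have h1 := key (Ω.indicator fun x => slopeSel f n (u x)) (m1.indicator hΩmeas) hR (by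
        intro x
        by_cases hx : x ∈ Ω
        · rw [indicator_of_mem hx]; exact hb _
        · rw [indicator_of_notMem hx]; simpa using hR)
      have e1 : ∫ x, Ω.indicator (fun x => slopeSel f n (u x)) x ∂μ
          = ∫ x in Ω, u x * slopeSel f n (u x) := by
        rw [integral_indicator hΩmeas]
        exact (setIntegral_rnDeriv_smul (f := fun x => slopeSel f n (u x)) hac hΩmeas).symm
      have e2 : ∫ x in Ω, fstar f (Ω.indicator (fun x => slopeSel f n (u x)) x)
          = ∫ x in Ω, fstar f (slopeSel f n (u x)) := by
        apply setIntegral_congr_fun hΩmeas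
        intro x hx
        simp only [indicator_of_mem hx]
      rw [e1, e2] at h1
      exact h1
    exact eintegral_iSup_le (fun n => (main n).1) (fun x => fapp_mono f (u x))
      (by filter_upwards with x; exact fapp_sup f hfbot hfconv hflsc hfsl hs0 (u x))
      (fun n => (main n).2)
  · obtain ⟨E, hE1, hE2, hE3⟩ : ∃ E, MeasurableSet E ∧ volume E = 0 ∧ μ E ≠ 0 := by
      by_contra hcon
      push Not at hcon
      exact hac (Measure.AbsolutelyContinuous.mk fun E h1 h2 => hcon E h1 h2)
    have hpos : 0 < μ.real E := by
      rw [measureReal_def]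
      exact ENNReal.toReal_pos hE3 (measure_ne_top _ _)
    have h2 : ∀ n : ℕ, ((n * μ.real E - ∫ x in Ω, fstar f 0 : ℝ) : EReal) ≤ S := by
      intro n
      have h1 := key (E.indicator fun _ => (n:ℝ)) (measurable_const.indicator hE1)
        (R := n) (by positivity) (by
        intro x
        by_cases hx : x ∈ E
        · rw [indicator_of_mem hx]; simp
        · rw [indicator_of_notMem hx]; simp)
      rw [integral_indicator hE1, setIntegral_const, smul_eq_mul, mul_comm] at h1
      have e2 : ∫ x in Ω, fstar f (E.indicator (fun _ => (n:ℝ)) x) = ∫ x in Ω, fstar f 0 := by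
        apply integral_congr_ae
        have : ∀ᵐ x ∂(volume.restrict Ω), x ∉ E := by
          apply ae_restrict_of_ae
          rw [ae_iff]
          simpa using hE2
        filter_upwards [this] with x hx
        rw [indicator_of_notMem hx]
      rwa [e2] at h1
    induction S with
    | top => exact le_rfl
    | bot => exact absurd (h2 0) (not_le.2 (EReal.bot_lt_coe _))
    | coe S =>
      exfalso
      simp only [EReal.coe_le_coe_iff] at h2
      obtain ⟨n, hn⟩ := exists_nat_gt ((S + ∫ x in Ω, fstar f 0) / μ.real E)
      rw [div_lt_iff₀ hpos] at hn
      linarith [h2 n]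

theorem phi_modulus {d : ℕ} (φ : Euc d → ℝ) (hφ : Continuous φ) (hφc : HasCompactSupport φ)
    {δ : ℝ} (hδ : 0 < δ) : ∃ c : ℝ, 0 < c ∧ ∀ x y, φ x - φ y ≤ δ + c * dist x y ^ 2 := by
  have huc : UniformContinuous φ := hφc.uniformContinuous_of_continuous hφ
  obtain ⟨η, hη, h1⟩ := Metric.uniformContinuous_iff.1 huc δ hδ
  obtain ⟨B, hB⟩ := hφc.exists_bound_of_continuous hφ
  have hB0 : 0 ≤ B := (norm_nonneg _).trans (hB 0)
  refine ⟨(2 * B + 1) / η ^ 2, by positivity, fun x y => ?_⟩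
  have hnn : 0 ≤ (2 * B + 1) / η ^ 2 * dist x y ^ 2 := by positivity
  by_cases h : dist x y < η
  · have := h1 h
    rw [Real.dist_eq] at this
    linarith [le_abs_self (φ x - φ y)]
  · push Not at h
    have h2 : η ^ 2 ≤ dist x y ^ 2 := by gcongr
    have h3 : 2 * B + 1 ≤ (2 * B + 1) / η ^ 2 * dist x y ^ 2 := by
      rw [div_mul_eq_mul_div, le_div_iff₀ (by positivity)]
      gcongr
    have h4 := abs_le.1 (hB x)
    have h5 := abs_le.1 (hB y)
    linarith

theorem W2_transport {d : ℕ} (φ : Euc d → ℝ) (hφ : Continuous φ) (hφc : HasCompactSupport φ)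
    {δ c : ℝ} (hc : 0 < c) (hmod : ∀ x y, φ x - φ y ≤ δ + c * dist x y ^ 2)
    (μ ρ : Measure (Euc d)) [IsProbabilityMeasure μ] [IsProbabilityMeasure ρ]
    (hW : W2sq μ ρ ≠ ⊤) :
    ∫ x, φ x ∂μ - δ - c * (W2sq μ ρ).toReal ≤ ∫ x, φ x ∂ρ := by
  have key : ENNReal.ofReal (∫ x, φ x ∂μ - ∫ x, φ x ∂ρ - δ) / ENNReal.ofReal c ≤ W2sq μ ρ := by
    unfold W2sq
    refine le_iInf₂ fun π hπ => ?_
    obtain ⟨hπ1, hπ2⟩ := hπ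
    have hP : IsProbabilityMeasure π := by
      constructor
      have : π.map Prod.fst univ = 1 := by rw [hπ1]; simp
      rwa [Measure.map_apply measurable_fst MeasurableSet.univ, preimage_univ] at this
    obtain ⟨B, hB⟩ := hφc.exists_bound_of_continuous hφ
    have i1 : Integrable (fun p : Euc d × Euc d => φ p.1) π :=
      Integrable.of_bound (hφ.measurable.comp measurable_fst).aestronglyMeasurable B
        (by filter_upwards with p using hB _)
    have i2 : Integrable (fun p : Euc d × Euc d => φ p.2) π :=
      Integrable.of_bound (hφ.measurable.comp measurable_snd).aestronglyMeasurable B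
        (by filter_upwards with p using hB _)
    have e1 : ∫ x, φ x ∂μ = ∫ p, φ p.1 ∂π := by
      rw [← hπ1, integral_map measurable_fst.aemeasurable hφ.measurable.aestronglyMeasurable]
    have e2 : ∫ x, φ x ∂ρ = ∫ p, φ p.2 ∂π := by
      rw [← hπ2, integral_map measurable_snd.aemeasurable hφ.measurable.aestronglyMeasurable]
    have e3 : ∫ x, φ x ∂μ - ∫ x, φ x ∂ρ - δ = ∫ p, (φ p.1 - φ p.2 - δ) ∂π := by
      have i3 : Integrable (fun p : Euc d × Euc d => φ p.1 - φ p.2) π := i1.sub i2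
      rw [integral_sub i3 (integrable_const _), integral_sub i1 i2, e1, e2]
      simp
    have i4 : Integrable (fun p : Euc d × Euc d => φ p.1 - φ p.2 - δ) π :=
      (i1.sub i2).sub (integrable_const _)
    rw [e3]
    apply ENNReal.div_le_of_le_mul
    rw [mul_comm, ← lintegral_const_mul _ (by fun_prop)]
    refine le_trans (b := ∫⁻ p, ENNReal.ofReal (φ p.1 - φ p.2 - δ) ∂π) ?_ ?_
    · apply ENNReal.ofReal_le_of_le_toReal
      rw [integral_eq_lintegral_pos_part_sub_lintegral_neg_part i4]
      simp
    · apply lintegral_mono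
      intro p
      simp only
      rw [← ENNReal.ofReal_mul hc.le]
      apply ENNReal.ofReal_le_ofReal
      linarith [hmod p.1 p.2]
  rw [ENNReal.div_le_iff (by simpa using hc) ENNReal.ofReal_ne_top] at key
  have h2 := ENNReal.toReal_mono (ENNReal.mul_ne_top hW ENNReal.ofReal_ne_top) key
  rw [ENNReal.toReal_mul, ENNReal.toReal_ofReal hc.le, ENNReal.toReal_ofReal'] at h2
  have := le_max_left (∫ x, φ x ∂μ - ∫ x, φ x ∂ρ - δ) 0
  linarith

open scoped ProbabilityTheory in
theorem coupling_lift {d : ℕ} {T : ℝ} (hT : 0 ≤ T) (t0 : ℝ) (Q : Measure (Traj d T))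
    [IsProbabilityMeasure Q] (ρ : Measure (Euc d)) (π : Measure (Euc d × Euc d))
    (h1 : π.map Prod.fst = Q.map (evalAt hT t0)) (h2 : π.map Prod.snd = ρ) :
    ∃ π' : Measure (Traj d T × Euc d), π'.map Prod.fst = Q ∧ π'.map Prod.snd = ρ ∧
      π'.map (Prod.map (evalAt hT t0) id) = π := by
  have hem : Measurable (evalAt (d := d) hT t0) := (evalAt_continuous_traj hT t0).measurable
  have hP : IsProbabilityMeasure π := by
    constructor
    have : π.map Prod.fst univ = 1 := by
      rw [h1]
      have : IsProbabilityMeasure (Q.map (evalAt hT t0)) :=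
        Measure.isProbabilityMeasure_map hem.aemeasurable
      simp
    rwa [Measure.map_apply measurable_fst MeasurableSet.univ, preimage_univ] at this
  set κ := π.condKernel with hκ
  have hdis : (Q.map (evalAt hT t0)) ⊗ₘ κ = π := by
    rw [← h1]; exact π.disintegrate κ
  have h3 : (Q ⊗ₘ (κ.comap (evalAt hT t0) hem)).map (Prod.map (evalAt hT t0) id) = π := by
    rw [← hdis]
    have : IsProbabilityMeasure (Q.map (evalAt hT t0)) :=
        Measure.isProbabilityMeasure_map hem.aemeasurable
    ext s hs
    rw [Measure.map_apply (by fun_prop) hs, Measure.compProd_apply (hs.preimage (by fun_prop)),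
      Measure.compProd_apply hs, lintegral_map (ProbabilityTheory.Kernel.measurable_kernel_prodMk_left hs) hem]
    rfl
  refine ⟨_, ?_, ?_, h3⟩
  · exact Measure.fst_compProd _ _
  · rw [← h2, ← h3, Measure.map_map measurable_snd (by fun_prop)]
    rfl

theorem W2_usc {d : ℕ} {T : ℝ} (hT : 0 ≤ T) (Ω : Set (Euc d)) (hΩc : IsCompact Ω)
    (Q : Measure (Traj d T)) [IsProbabilityMeasure Q] {R : ℝ} (hR : ∀ᵐ γ ∂Q, ‖γ‖ ≤ R)
    (ρ : Measure (Euc d)) (hρ : ρ Ωᶜ = 0) :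
    UpperSemicontinuous (fun t => W2sq (Q.map (evalAt hT t)) ρ) := by
  intro t0 y hy
  simp only [W2sq, iInf_lt_iff] at hy
  obtain ⟨π, ⟨h1, h2⟩, h3⟩ := hy
  obtain ⟨π', k1, k2, k3⟩ := coupling_lift hT t0 Q ρ π h1 h2
  have hem : ∀ t, Measurable (evalAt (d := d) hT t) := fun t => (evalAt_continuous_traj hT t).measurable
  have hP : IsProbabilityMeasure π' := by
    constructor
    have : π'.map Prod.fst univ = 1 := by rw [k1]; simp
    rwa [Measure.map_apply measurable_fst MeasurableSet.univ, preimage_univ] at this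
  have hmm : ∀ t, Measurable (Prod.map (evalAt hT t) id : Traj d T × Euc d → Euc d × Euc d) :=
    fun t => (hem t).prodMap measurable_id
  have hcost : ∀ t, ∫⁻ p, ENNReal.ofReal (dist p.1 p.2 ^ 2) ∂(π'.map (Prod.map (evalAt hT t) id))
      = ∫⁻ p, ENNReal.ofReal (dist (evalAt hT t p.1) p.2 ^ 2) ∂π' := by
    intro t
    rw [lintegral_map (by fun_prop) (hmm t)]
    rfl
  have hle : ∀ t, W2sq (Q.map (evalAt hT t)) ρ ≤
      ∫⁻ p, ENNReal.ofReal (dist (evalAt hT t p.1) p.2 ^ 2) ∂π' := by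
    intro t
    rw [← hcost]
    unfold W2sq
    refine iInf₂_le _ ⟨?_, ?_⟩
    · rw [Measure.map_map measurable_fst (hmm t), ← k1, Measure.map_map (hem t) measurable_fst]
      rfl
    · rw [Measure.map_map measurable_snd (hmm t), ← k2]
      rfl
  obtain ⟨R', hR'⟩ := hΩc.isBounded.exists_norm_le
  have a1 : ∀ᵐ p ∂π', ‖p.1‖ ≤ R := by
    rw [← k1] at hR
    exact ae_of_ae_map measurable_fst.aemeasurable hR
  have a2 : ∀ᵐ p ∂π', p.2 ∈ Ω := by
    have : ∀ᵐ x ∂ρ, x ∈ Ω := by rw [ae_iff]; exact hρ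
    rw [← k2] at this
    exact ae_of_ae_map measurable_snd.aemeasurable this
  have htend : Tendsto (fun t => ∫⁻ p, ENNReal.ofReal (dist (evalAt hT t p.1) p.2 ^ 2) ∂π') (𝓝 t0)
      (𝓝 (∫⁻ p, ENNReal.ofReal (dist (evalAt hT t0 p.1) p.2 ^ 2) ∂π')) := by
    refine tendsto_lintegral_filter_of_dominated_convergence
      (fun _ => ENNReal.ofReal ((R + R') ^ 2)) ?_ ?_ ?_ ?_
    · filter_upwards with t
      exact ((((hem t).comp measurable_fst).dist measurable_snd).pow_const 2).ennreal_ofReal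
    · filter_upwards with t
      filter_upwards [a1, a2] with p hp1 hp2
      apply ENNReal.ofReal_le_ofReal
      have b1 : ‖evalAt hT t p.1‖ ≤ R := (ContinuousMap.norm_coe_le_norm _ _).trans hp1
      have b2 := hR' _ hp2
      have : dist (evalAt hT t p.1) p.2 ≤ R + R' := by
        rw [dist_eq_norm]
        exact (norm_sub_le _ _).trans (add_le_add b1 b2)
      gcongr
    · simp
    · filter_upwards with p
      apply (ENNReal.continuous_ofReal.tendsto _).comp
      have := evalAt_continuous_time hT p.1
      have : Continuous fun t => dist (evalAt hT t p.1) p.2 ^ 2 := by fun_prop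
      exact this.tendsto t0
  rw [← k3, hcost] at h3
  filter_upwards [htend.eventually (gt_mem_nhds h3)] with t ht
  exact (hle t).trans_lt ht

theorem moreau_measurable {d : ℕ} {T : ℝ} (hT : 0 ≤ T) (Ω : Set (Euc d)) (hΩc : IsCompact Ω)
    (Q : Measure (Traj d T)) [IsProbabilityMeasure Q] {R : ℝ} (hR : ∀ᵐ γ ∂Q, ‖γ‖ ≤ R)
    (FE : Measure (Euc d) → EReal) (hFE : ∀ ρ, FE ρ ≠ ⊥) {ε : ℝ} (hε : 0 < ε) :
    Measurable (fun t => moreauE Ω FE ε (Q.map (evalAt hT t))) := by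
  apply UpperSemicontinuous.measurable
  unfold moreauE
  refine upperSemicontinuous_biInf fun ρ hρ => ?_
  have h1 := W2_usc hT Ω hΩc Q hR ρ hρ.2
  have hc : Continuous (fun x : ℝ≥0∞ => ((x / ENNReal.ofReal (2 * ε) : ℝ≥0∞) : EReal) + FE ρ) := by
    rw [continuous_iff_continuousAt]
    intro x
    have h2 : ContinuousAt (fun x : ℝ≥0∞ => ((x / ENNReal.ofReal (2 * ε) : ℝ≥0∞) : EReal)) x :=
      (continuous_coe_ennreal_ereal.comp
        (ENNReal.continuous_div_const _ (by simpa using hε))).continuousAt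
    have h3 : ContinuousAt (fun p : EReal × EReal => p.1 + p.2)
        (((x / ENNReal.ofReal (2 * ε) : ℝ≥0∞) : EReal), FE ρ) :=
      EReal.continuousAt_add (Or.inr (hFE ρ)) (Or.inl (EReal.coe_ennreal_ne_bot _))
    exact ContinuousAt.comp (f := fun x : ℝ≥0∞ => (((x / ENNReal.ofReal (2 * ε) : ℝ≥0∞) : EReal), FE ρ))
      h3 (h2.prodMk continuousAt_const)
  refine hc.comp_upperSemicontinuous h1 fun x y hxy => ?_
  simp only
  gcongr
  exact EReal.coe_ennreal_le_coe_ennreal_iff.2 (ENNReal.div_le_div_right hxy _)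

theorem unif_bound {d : ℕ} {T : ℝ} (N : ℕ) (Q : Measure (Traj d T)) (h : IsUnifDiscrete N Q) :
    ∃ R, ∀ᵐ γ ∂Q, ‖γ‖ ≤ R := by
  obtain ⟨x, rfl⟩ := h
  refine ⟨∑ i, ‖x i‖, ?_⟩
  apply Measure.ae_smul_measure
  rw [← Measure.sum_fintype, Measure.ae_sum_iff]
  intro i
  rw [ae_dirac_iff (measurableSet_le measurable_norm measurable_const)]
  exact Finset.single_le_sum (f := fun i => ‖x i‖) (fun i _ => norm_nonneg _) (Finset.mem_univ i)

theorem unif_prob {X : Type*} [MeasurableSpace X] (N : ℕ) (μ : Measure X)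
    (h : IsUnifDiscrete (N+1) μ) : IsProbabilityMeasure μ := by
  obtain ⟨x, rfl⟩ := h
  constructor
  simp only [Measure.smul_apply, Measure.coe_finsetSum, Finset.sum_apply, measure_univ, smul_eq_mul]
  simp only [Finset.sum_const, Finset.card_univ, Fintype.card_fin, nsmul_eq_mul, mul_one]
  exact ENNReal.inv_mul_cancel (by simp) (ENNReal.natCast_ne_top _)

theorem intFE_ge {d : ℕ} (Ω : Set (Euc d)) (hΩc : IsCompact Ω) (f : ℝ → EReal) {c : ℝ}
    (hc : ∀ x, ((-c : ℝ) : EReal) ≤ f x) (ρ : Measure (Euc d)) :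
    ((-(c * volume.real Ω) : ℝ) : EReal) ≤ intFE Ω f ρ := by
  unfold intFE
  split_ifs
  swap
  · exact le_top
  have : IsFiniteMeasure (volume.restrict Ω) := ⟨by simpa using hΩc.measure_lt_top⟩
  have e := eintegral_real (integrable_const (μ := volume.restrict Ω) (-c))
  have e2 : ∫ _ in Ω, (-c) = -(c * volume.real Ω) := by
    rw [setIntegral_const, smul_eq_mul]; ring
  rw [← e2, ← e]
  exact eintegral_mono (by filter_upwards with x using hc _)

/-- the dual affine functional attached to a test function -/
def dualv {d : ℕ} (Ω : Set (Euc d)) (f : ℝ → EReal) (φ : Euc d → ℝ) (μ : Measure (Euc d)) : ℝ :=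
  ∫ x, φ x ∂μ - ∫ x in Ω, fstar f (φ x)

theorem integral_evalAt {d : ℕ} {T : ℝ} (hT : 0 ≤ T) (φ : Euc d → ℝ) (hφ : Continuous φ)
    (Q : Measure (Traj d T)) (t : ℝ) :
    ∫ x, φ x ∂(Q.map (evalAt hT t)) = ∫ γ, φ (evalAt hT t γ) ∂Q :=
  integral_map (evalAt_continuous_traj hT t).measurable.aemeasurable
    hφ.measurable.aestronglyMeasurable

theorem dualv_cont_time {d : ℕ} {T : ℝ} (hT : 0 ≤ T) (Ω : Set (Euc d)) (f : ℝ → EReal)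
    (φ : Euc d → ℝ) (hφ : Continuous φ) (hφc : HasCompactSupport φ)
    (Q : Measure (Traj d T)) [IsProbabilityMeasure Q] :
    Continuous fun t => dualv Ω f φ (Q.map (evalAt hT t)) := by
  unfold dualv
  refine Continuous.sub ?_ continuous_const
  simp only [integral_evalAt hT φ hφ]
  obtain ⟨B, hB⟩ := hφc.exists_bound_of_continuous hφ
  refine continuous_of_dominated (bound := fun _ => B) ?_ ?_ (integrable_const _) ?_
  · intro t
    exact (hφ.comp (evalAt_continuous_traj hT t)).measurable.aestronglyMeasurable
  · intro t
    filter_upwards with γ using hB _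
  · filter_upwards with γ
    exact hφ.comp (evalAt_continuous_time hT γ)

theorem dualv_narrow {d : ℕ} {T : ℝ} (hT : 0 ≤ T) (Ω : Set (Euc d)) (f : ℝ → EReal)
    (φ : Euc d → ℝ) (hφ : Continuous φ) (hφc : HasCompactSupport φ)
    (Q : ℕ → Measure (Traj d T)) (Qm : Measure (Traj d T)) (h : NarrowTendsto Q Qm) (t : ℝ) :
    Tendsto (fun N => dualv Ω f φ ((Q N).map (evalAt hT t))) atTop
      (𝓝 (dualv Ω f φ (Qm.map (evalAt hT t)))) := by
  unfold dualv
  refine Tendsto.sub ?_ tendsto_const_nhds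
  simp only [integral_evalAt hT φ hφ]
  obtain ⟨B, hB⟩ := hφc.exists_bound_of_continuous hφ
  exact h (BoundedContinuousFunction.ofNormedAddCommGroup (fun γ => φ (evalAt hT t γ))
    (hφ.comp (evalAt_continuous_traj hT t)) B (fun γ => hB _))

theorem dualv_bdd {d : ℕ} (Ω : Set (Euc d)) (f : ℝ → EReal)
    (φ : Euc d → ℝ) (hφ : Continuous φ) (hφc : HasCompactSupport φ) :
    ∃ B, ∀ μ : Measure (Euc d), IsProbabilityMeasure μ → |dualv Ω f φ μ| ≤ B := by
  obtain ⟨B, hB⟩ := hφc.exists_bound_of_continuous hφ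
  refine ⟨B + |∫ x in Ω, fstar f (φ x)|, fun μ hμ => ?_⟩
  unfold dualv
  refine (abs_sub _ _).trans ?_
  gcongr
  have := norm_integral_le_of_norm_le_const (μ := μ) (f := φ) (C := B) (by filter_upwards with x using hB x)
  simpa using this

/-- finite maxima of the dual functionals -/
def Phik {d : ℕ} (Ω : Set (Euc d)) (f : ℝ → EReal) (φ : ℕ → Euc d → ℝ) (k : ℕ)
    (μ : Measure (Euc d)) : ℝ := partialSups (fun i => dualv Ω f (φ i) μ) k

theorem Phik_zero {d : ℕ} (Ω : Set (Euc d)) (f : ℝ → EReal) (φ : ℕ → Euc d → ℝ)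
    (μ : Measure (Euc d)) : Phik Ω f φ 0 μ = dualv Ω f (φ 0) μ := by simp [Phik]

theorem Phik_succ {d : ℕ} (Ω : Set (Euc d)) (f : ℝ → EReal) (φ : ℕ → Euc d → ℝ) (k : ℕ)
    (μ : Measure (Euc d)) :
    Phik Ω f φ (k+1) μ = max (Phik Ω f φ k μ) (dualv Ω f (φ (k+1)) μ) := by
  simp [Phik, partialSups_add_one]

theorem Phik_cont_time {d : ℕ} {T : ℝ} (hT : 0 ≤ T) (Ω : Set (Euc d)) (f : ℝ → EReal)
    (φ : ℕ → Euc d → ℝ) (hφ : ∀ i, Continuous (φ i)) (hφc : ∀ i, HasCompactSupport (φ i))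
    (Q : Measure (Traj d T)) [IsProbabilityMeasure Q] (k : ℕ) :
    Continuous fun t => Phik Ω f φ k (Q.map (evalAt hT t)) := by
  induction k with
  | zero => simp only [Phik_zero]; exact dualv_cont_time hT Ω f _ (hφ 0) (hφc 0) Q
  | succ k ih =>
    simp only [Phik_succ]
    exact ih.max (dualv_cont_time hT Ω f _ (hφ _) (hφc _) Q)

theorem Phik_narrow {d : ℕ} {T : ℝ} (hT : 0 ≤ T) (Ω : Set (Euc d)) (f : ℝ → EReal)
    (φ : ℕ → Euc d → ℝ) (hφ : ∀ i, Continuous (φ i)) (hφc : ∀ i, HasCompactSupport (φ i))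
    (Q : ℕ → Measure (Traj d T)) (Qm : Measure (Traj d T)) (h : NarrowTendsto Q Qm) (t : ℝ) (k : ℕ) :
    Tendsto (fun N => Phik Ω f φ k ((Q N).map (evalAt hT t))) atTop
      (𝓝 (Phik Ω f φ k (Qm.map (evalAt hT t)))) := by
  induction k with
  | zero => simp only [Phik_zero]; exact dualv_narrow hT Ω f _ (hφ 0) (hφc 0) Q Qm h t
  | succ k ih =>
    simp only [Phik_succ]
    exact ih.max (dualv_narrow hT Ω f _ (hφ _) (hφc _) Q Qm h t)

theorem Phik_bdd {d : ℕ} (Ω : Set (Euc d)) (f : ℝ → EReal)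
    (φ : ℕ → Euc d → ℝ) (hφ : ∀ i, Continuous (φ i)) (hφc : ∀ i, HasCompactSupport (φ i)) (k : ℕ) :
    ∃ B, ∀ μ : Measure (Euc d), IsProbabilityMeasure μ → |Phik Ω f φ k μ| ≤ B := by
  induction k with
  | zero => simp only [Phik_zero]; exact dualv_bdd Ω f _ (hφ 0) (hφc 0)
  | succ k ih =>
    obtain ⟨B1, h1⟩ := ih
    obtain ⟨B2, h2⟩ := dualv_bdd Ω f _ (hφ (k+1)) (hφc (k+1))
    refine ⟨max B1 B2, fun μ hμ => ?_⟩
    rw [Phik_succ]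
    exact abs_max_le_max_abs_abs.trans (max_le_max (h1 μ hμ) (h2 μ hμ))

theorem exists_dual_seq {d : ℕ} {T : ℝ} (hT : 0 ≤ T) (Ω : Set (Euc d)) (hΩc : IsCompact Ω)
    (hΩmeas : MeasurableSet Ω)
    (f : ℝ → EReal) (hfbot : ∀ t, f t ≠ ⊥) (hfconv : ConvexE f)
    (hflsc : LowerSemicontinuous f) (hfsl : SuperlinearE f) {s0 : ℝ} (hs0 : f s0 ≠ ⊤)
    (Q : Measure (Traj d T)) [IsProbabilityMeasure Q] :
    ∃ φ : ℕ → Euc d → ℝ, (∀ i, Continuous (φ i)) ∧ (∀ i, HasCompactSupport (φ i)) ∧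
      ∀ t, intFE Ω f (Q.map (evalAt hT t)) ≤
        ⨆ i, ((dualv Ω f (φ i) (Q.map (evalAt hT t)) : ℝ) : EReal) := by
  set A : Set (Euc d → ℝ) := {φ | Continuous φ ∧ HasCompactSupport φ} with hA
  set Ψ : (Euc d → ℝ) → ℝ → EReal := fun φ t =>
    ((dualv Ω f φ (Q.map (evalAt hT t)) : ℝ) : EReal) with hΨ
  obtain ⟨F', hF'1, hF'2, hF'3⟩ := exists_countable_lowerSemicontinuous_isLUB
    (s := sSup (Ψ '' A)) (𝓕 := Ψ '' A) (by
      rintro _ ⟨φ, hφ, rfl⟩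
      exact (continuous_coe_real_ereal.comp
        (dualv_cont_time hT Ω f φ hφ.1 hφ.2 Q)).lowerSemicontinuous) (isLUB_sSup _)
  have h0 : (0 : Euc d → ℝ) ∈ A := ⟨continuous_const, HasCompactSupport.zero⟩
  have hins : (insert (Ψ 0) F').Countable := hF'2.insert _
  obtain ⟨e, he⟩ := hins.exists_eq_range ⟨_, mem_insert _ _⟩
  have hmem : ∀ i, ∃ φ ∈ A, Ψ φ = e i := by
    intro i
    have : e i ∈ insert (Ψ 0) F' := by rw [he]; exact mem_range_self i
    rcases this with h | h
    · exact ⟨0, h0, h.symm⟩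
    · exact hF'1 h
  choose φ hφ1 hφ2 using hmem
  refine ⟨φ, fun i => (hφ1 i).1, fun i => (hφ1 i).2, fun t => ?_⟩
  have hP : IsProbabilityMeasure (Q.map (evalAt hT t)) :=
    Measure.isProbabilityMeasure_map (evalAt_continuous_traj hT t).measurable.aemeasurable
  refine intFE_dual Ω hΩc hΩmeas f hfbot hfconv hflsc hfsl hs0 _ _ fun ψ hψ1 hψ2 => ?_
  have h1 : Ψ ψ ≤ fun t => ⨆ i, Ψ (φ i) t := by
    have hψA : ψ ∈ A := ⟨hψ1, hψ2⟩
    refine le_trans (hF'3.1 |> fun _ => le_sSup (mem_image_of_mem Ψ hψA)) (hF'3.2 ?_)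
    intro g hg t
    have : g ∈ insert (Ψ 0) F' := mem_insert_of_mem _ hg
    rw [he] at this
    obtain ⟨i, rfl⟩ := this
    rw [← hφ2 i]
    exact le_iSup (fun i => Ψ (φ i) t) i
  exact h1 t

theorem moreau_ge {d : ℕ} (Ω : Set (Euc d)) (FE : Measure (Euc d) → EReal) {c : ℝ}
    (hc : ∀ ρ, ((-c : ℝ) : EReal) ≤ FE ρ) (ε : ℝ) (μ : Measure (Euc d)) :
    ((-c : ℝ) : EReal) ≤ moreauE Ω FE ε μ := by
  unfold moreauE
  refine le_iInf₂ fun ρ _ => ?_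
  calc ((-c : ℝ) : EReal) = 0 + ((-c : ℝ) : EReal) := by simp
    _ ≤ _ := add_le_add (EReal.coe_ennreal_nonneg _) (hc ρ)

theorem proj_lower {d : ℕ} (Ω : Set (Euc d)) (hΩc : IsCompact Ω) (hΩmeas : MeasurableSet Ω)
    (f : ℝ → EReal) (hfbot : ∀ t, f t ≠ ⊥)
    (hflsc : LowerSemicontinuous f) (hfsl : SuperlinearE f) {s0 : ℝ} (hs0 : f s0 ≠ ⊤)
    {c' : ℝ} (hc' : ∀ ρ, ((-c' : ℝ) : EReal) ≤ intFE Ω f ρ)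
    (φ : ℕ → Euc d → ℝ) (hφ : ∀ i, Continuous (φ i)) (hφc : ∀ i, HasCompactSupport (φ i)) (k : ℕ)
    {δ c : ℝ} (hc : 0 < c) (hmod : ∀ i ≤ k, ∀ x y, φ i x - φ i y ≤ δ + c * dist x y ^ 2)
    (μ ρ : Measure (Euc d)) [IsProbabilityMeasure μ] [IsProbabilityMeasure ρ] (hρ : ρ Ωᶜ = 0)
    {ε : ℝ} (hε : 0 < ε) (m : ℝ)
    (hm : (((W2sq μ ρ / ENNReal.ofReal (2 * ε)) : ℝ≥0∞) : EReal) + intFE Ω f ρ = (m : EReal)) :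
    ((Phik Ω f φ k μ - δ - 2 * c * ε * (m + c') : ℝ) : EReal) ≤ intFE Ω f ρ := by
  have hlow : ∀ i, ((dualv Ω f (φ i) ρ : ℝ) : EReal) ≤ intFE Ω f ρ := fun i =>
    intFE_lower Ω hΩc hΩmeas f hfbot hflsc hfsl hs0 ρ hρ (φ i) (hφ i) (hφc i)
  have hlb := hc' ρ
  generalize intFE Ω f ρ = X at *
  induction X with
  | bot => simp at hlb
  | top => exact le_top
  | coe x =>
    have hWq : W2sq μ ρ / ENNReal.ofReal (2 * ε) ≠ ⊤ := by
      intro h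
      rw [h] at hm
      simp at hm
    have hW : W2sq μ ρ ≠ ⊤ := by
      intro h
      rw [h, ENNReal.top_div_of_ne_top ENNReal.ofReal_ne_top] at hWq
      exact hWq rfl
    rw [← EReal.coe_ennreal_toReal hWq, ← EReal.coe_add, EReal.coe_eq_coe_iff, ENNReal.toReal_div,
      ENNReal.toReal_ofReal (by positivity)] at hm
    rw [EReal.coe_le_coe_iff] at hlb ⊢
    have hWle : (W2sq μ ρ).toReal ≤ 2 * ε * (m + c') := by
      have : (W2sq μ ρ).toReal / (2 * ε) ≤ m + c' := by linarith
      rw [div_le_iff₀ (by positivity)] at this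
      linarith
    have hall : Phik Ω f φ k μ ≤ x + δ + c * (W2sq μ ρ).toReal := by
      unfold Phik
      apply partialSups_le
      intro i hi
      have h1 := W2_transport (φ i) (hφ i) (hφc i) hc (hmod i hi) μ ρ hW
      have h2 := hlow i
      rw [EReal.coe_le_coe_iff] at h2
      unfold dualv at h2 ⊢
      linarith
    have := mul_le_mul_of_nonneg_left hWle hc.le
    linarith

theorem liminf_core {d : ℕ} {T : ℝ} (hT : 0 < T) (Ω : Set (Euc d)) (hΩc : IsCompact Ω)
    (hΩmeas : MeasurableSet Ω)
    (f : ℝ → EReal) (hfbot : ∀ t, f t ≠ ⊥) (hfconv : ConvexE f)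
    (hflsc : LowerSemicontinuous f) (hfsl : SuperlinearE f) {s0 : ℝ} (hs0 : f s0 ≠ ⊤)
    {c' : ℝ} (hc' : ∀ ρ, ((-c' : ℝ) : EReal) ≤ intFE Ω f ρ)
    (Qmin : Measure (Traj d T)) (hQminP : IsProbabilityMeasure Qmin)
    (ε : ℕ → ℝ) (hεpos : ∀ N, 0 < ε N) (hεlim : Tendsto ε atTop (𝓝 0))
    (Q : ℕ → Measure (Traj d T)) (hQP : ∀ N, IsProbabilityMeasure (Q N))
    (hQR : ∀ N, ∃ R, ∀ᵐ γ ∂(Q N), ‖γ‖ ≤ R)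
    (hQcv : NarrowTendsto Q Qmin)
    (ρproj : ℕ → ℝ → Measure (Euc d))
    (hproj : ∀ N, ∀ t ∈ Set.Ioc (0:ℝ) T,
      IsProbabilityMeasure (ρproj N t) ∧ (ρproj N t) Ωᶜ = 0 ∧
      (((W2sq ((Q N).map (evalAt hT.le t)) (ρproj N t) / ENNReal.ofReal (2 * ε N))
          : ℝ≥0∞) : EReal) + intFE Ω f (ρproj N t)
        = moreauE Ω (intFE Ω f) (ε N) ((Q N).map (evalAt hT.le t)))
    (b : ℝ) (hb : ∀ᶠ N in atTop, eintegral (volume.restrict (Set.Ioc (0:ℝ) T))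
        (fun t => moreauE Ω (intFE Ω f) (ε N) ((Q N).map (evalAt hT.le t))) ≤ (b : EReal))
    (a : EReal) (ha : a < eintegral (volume.restrict (Set.Ioc (0:ℝ) T))
        (fun t => intFE Ω f (Qmin.map (evalAt hT.le t)))) :
    ∀ᶠ N in atTop, a < eintegral (volume.restrict (Set.Ioc (0:ℝ) T))
        (fun t => intFE Ω f (ρproj N t)) := by
  obtain ⟨φ, hφ, hφc, hsup⟩ := exists_dual_seq hT.le Ω hΩc hΩmeas f hfbot hfconv hflsc hfsl hs0 Qmin
  have hem : ∀ t, Measurable (evalAt (d := d) hT.le t) :=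
    fun t => (evalAt_continuous_traj hT.le t).measurable
  have hPmap : ∀ (P : Measure (Traj d T)), IsProbabilityMeasure P → ∀ t,
      IsProbabilityMeasure (P.map (evalAt hT.le t)) := fun P _ t =>
    Measure.isProbabilityMeasure_map (hem t).aemeasurable
  set lam := volume.restrict (Set.Ioc (0:ℝ) T) with hlam
  have hlamF : IsFiniteMeasure lam := ⟨by simp [hlam]⟩
  have hlamr : lam.real univ = T := by simp [hlam, measureReal_def, hT.le]
  have hIntg : ∀ (P : Measure (Traj d T)), IsProbabilityMeasure P → ∀ k,
      Integrable (fun t => Phik Ω f φ k (P.map (evalAt hT.le t))) lam := by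
    intro P hP k
    obtain ⟨B, hB⟩ := Phik_bdd Ω f φ hφ hφc k
    exact Integrable.of_bound
      (Phik_cont_time hT.le Ω f φ hφ hφc P k).measurable.aestronglyMeasurable B
      (by filter_upwards with t using hB _ (hPmap P hP t))
  obtain ⟨k, hk⟩ : ∃ k, a < ((∫ t, Phik Ω f φ k (Qmin.map (evalAt hT.le t)) ∂lam : ℝ) : EReal) := by
    by_contra hcon
    push Not at hcon
    refine absurd ha (not_lt.2 (eintegral_iSup_le (hIntg Qmin hQminP) ?_ ?_ hcon))
    · intro t
      exact (partialSups (fun i => dualv Ω f (φ i) (Qmin.map (evalAt hT.le t)))).monotone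
    · filter_upwards with t
      refine (hsup t).trans (iSup_mono fun i => ?_)
      rw [EReal.coe_le_coe_iff]
      exact le_partialSups (fun i => dualv Ω f (φ i) (Qmin.map (evalAt hT.le t))) i
  obtain ⟨a', ha1, ha2⟩ := EReal.lt_iff_exists_real_btwn.1 hk
  rw [EReal.coe_lt_coe_iff] at ha2
  set I := ∫ t, Phik Ω f φ k (Qmin.map (evalAt hT.le t)) ∂lam with hI
  set δ := (I - a') / (3 * T) with hδ
  have hδ0 : 0 < δ := by apply div_pos <;> linarith
  have hδT : δ * T = (I - a') / 3 := by rw [hδ]; field_simp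
  choose cs hcs0 hcs using fun i => phi_modulus (φ i) (hφ i) (hφc i) hδ0
  set c := ∑ i ∈ Finset.range (k+1), cs i with hc
  have hcpos : 0 < c := Finset.sum_pos (fun i _ => hcs0 i) ⟨0, by simp⟩
  have hmod : ∀ i ≤ k, ∀ x y, φ i x - φ i y ≤ δ + c * dist x y ^ 2 := by
    intro i hi x y
    refine (hcs i x y).trans ?_
    have : cs i ≤ c := Finset.single_le_sum (f := cs) (fun i _ => (hcs0 i).le)
      (Finset.mem_range.2 (Nat.lt_succ_of_le hi))
    gcongr
  have hIN : Tendsto (fun N => ∫ t, Phik Ω f φ k ((Q N).map (evalAt hT.le t)) ∂lam) atTop (𝓝 I) := by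
    obtain ⟨B, hB⟩ := Phik_bdd Ω f φ hφ hφc k
    refine tendsto_integral_of_dominated_convergence (fun _ => B) ?_ (integrable_const _) ?_ ?_
    · intro N; exact (hIntg _ (hQP N) k).1
    · intro N; filter_upwards with t using hB _ (hPmap _ (hQP N) t)
    · filter_upwards with t
      exact Phik_narrow hT.le Ω f φ hφ hφc Q Qmin hQcv t k
  have hE : Tendsto (fun N => 2 * c * ε N * (b + c' * T)) atTop (𝓝 0) := by
    have := (hεlim.const_mul (2 * c)).mul_const (b + c' * T)
    simpa using this
  filter_upwards [hb, hIN.eventually (lt_mem_nhds (show I - (I - a') / 3 < I by linarith)),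
    hE.eventually (gt_mem_nhds (show 0 < (I - a') / 3 by linarith))] with N hN1 hN2 hN3
  refine ha1.trans ?_
  obtain ⟨R, hR⟩ := hQR N
  have := hQP N
  have hMm := moreau_measurable hT.le Ω hΩc (Q N) hR (intFE Ω f)
    (fun ρ h => by have := hc' ρ; rw [h] at this; simp at this) (hεpos N)
  obtain ⟨m1, m2, m3⟩ := eintegral_finite (μ := lam) hMm.aemeasurable
    (fun t => moreau_ge Ω (intFE Ω f) hc' (ε N) _) (ne_top_of_le_ne_top (EReal.coe_ne_top b) hN1)
  rw [m3, EReal.coe_le_coe_iff] at hN1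
  set M : ℝ → ℝ := fun t => (moreauE Ω (intFE Ω f) (ε N) ((Q N).map (evalAt hT.le t))).toReal with hM
  have i1 := hIntg _ (hQP N) k
  have i2 : Integrable (fun t => Phik Ω f φ k ((Q N).map (evalAt hT.le t)) - δ) lam :=
    i1.sub (integrable_const _)
  have i3 : Integrable (fun t => M t + c') lam := m2.add (integrable_const _)
  have i4 : Integrable (fun t => 2 * c * ε N * (M t + c')) lam := i3.const_mul _
  have i5 : Integrable (fun t => Phik Ω f φ k ((Q N).map (evalAt hT.le t)) - δ
      - 2 * c * ε N * (M t + c')) lam := i2.sub i4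
  refine lt_of_lt_of_le ?_ (eintegral_mono (g := fun t =>
    ((Phik Ω f φ k ((Q N).map (evalAt hT.le t)) - δ - 2 * c * ε N * (M t + c') : ℝ) : EReal)) ?_)
  · rw [eintegral_real i5, EReal.coe_lt_coe_iff, integral_sub i2 i4, integral_sub i1 (integrable_const _),
      integral_const_mul, integral_add m2 (integrable_const _), integral_const, integral_const, hlamr,
      smul_eq_mul, smul_eq_mul]
    have h5 : 0 ≤ 2 * c * ε N := by have := hεpos N; positivity
    have h6 := mul_le_mul_of_nonneg_left (show ∫ t, M t ∂lam + T * c' ≤ b + c' * T by linarith) h5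
    linarith
  · have hmem : ∀ᵐ t ∂lam, t ∈ Set.Ioc (0:ℝ) T := ae_restrict_mem measurableSet_Ioc
    filter_upwards [m1, hmem] with t ht1 ht2
    obtain ⟨p1, p2, p3⟩ := hproj N t ht2
    have := hPmap _ (hQP N) t
    exact proj_lower Ω hΩc hΩmeas f hfbot hflsc hfsl hs0 hc' φ hφ hφc k hcpos hmod _ _ p2 (hεpos N)
      (M t) (p3.trans ht1)

theorem sum_finite (k : ℝ≥0∞) (c : ℝ) (B : EReal) (g : ℝ) (hB : B ≠ ⊥)
    (h : (k : EReal) - ((c : ℝ) : EReal) + B + ((g : ℝ) : EReal) ≠ ⊤) : k ≠ ⊤ ∧ B ≠ ⊤ := by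
  constructor
  · rintro rfl
    apply h
    rw [EReal.coe_ennreal_top, EReal.top_sub_coe, EReal.top_add_of_ne_bot hB, EReal.top_add_coe]
  · rintro rfl
    apply h
    rw [EReal.add_top_of_ne_bot, EReal.top_add_coe]
    rw [sub_eq_add_neg, ← EReal.coe_neg]
    intro h'
    rw [EReal.add_eq_bot_iff] at h'
    rcases h' with h' | h'
    · exact EReal.coe_ennreal_ne_bot _ h'
    · exact EReal.coe_ne_bot _ h'

theorem eintegral_top {α : Type*} [MeasurableSpace α] (μ : Measure α) (h : μ ≠ 0) :
    eintegral μ (fun _ => (⊤ : EReal)) = ⊤ := by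
  have h1 : ERtoENN ⊤ = ⊤ := by simp [ERtoENN]
  have h2 : ERtoENN (-⊤) = 0 := by simp [ERtoENN]
  unfold eintegral
  beta_reduce
  rw [h1, h2, lintegral_const, ENNReal.top_mul (by simpa using h)]
  simp

theorem exists_finite_value {d : ℕ} {T : ℝ} (hT : 0 < T) (Ω : Set (Euc d)) (f : ℝ → EReal)
    (hΩ : volume Ω ≠ 0) (m : ℝ → Measure (Euc d))
    (h : eintegral (volume.restrict (Set.Ioc (0:ℝ) T)) (fun t => intFE Ω f (m t)) ≠ ⊤) :
    ∃ s0, f s0 ≠ ⊤ := by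
  by_contra hcon
  push Not at hcon
  apply h
  have e : ∀ t, intFE Ω f (m t) = ⊤ := by
    intro t
    unfold intFE
    split_ifs
    · simp only [hcon]
      exact eintegral_top _ (by simpa [Measure.restrict_eq_zero] using hΩ)
    · rfl
  simp only [e]
  exact eintegral_top _ (by simpa [Measure.restrict_eq_zero] using hT)

theorem J_ne_top {d : ℕ} (hd : 0 < d) {T : ℝ} (hT : 0 < T) (Ω : Set (Euc d)) (hΩc : IsCompact Ω)
    (J : Measure (Traj d T) → EReal)
    (μ0 : Measure (Euc d)) (hμ0 : IsProbabilityMeasure μ0)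
    (hμ0Ω : μ0 Ωᶜ = 0)
    (Qmin : Measure (Traj d T))
    (hQminmin : ∀ Q : Measure (Traj d T), IsProbabilityMeasure Q →
      Q.map (evalAt hT.le 0) = μ0 → J Qmin ≤ J Q)
    (hQminuniq : ∀ Q : Measure (Traj d T), IsProbabilityMeasure Q →
      Q.map (evalAt hT.le 0) = μ0 →
      (∀ Q' : Measure (Traj d T), IsProbabilityMeasure Q' →
        Q'.map (evalAt hT.le 0) = μ0 → J Q ≤ J Q') → Q = Qmin) : J Qmin ≠ ⊤ := by
  intro htop
  have hall : ∀ Q : Measure (Traj d T), IsProbabilityMeasure Q →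
      Q.map (evalAt hT.le 0) = μ0 → Q = Qmin := by
    intro Q hQ hQ0
    refine hQminuniq Q hQ hQ0 fun Q' hQ' hQ'0 => ?_
    have := hQminmin Q' hQ' hQ'0
    rw [htop, top_le_iff] at this
    rw [this]; exact le_top
  let φ : Traj d T → Euc d → Traj d T := fun w x => ContinuousMap.const _ x + w
  have hφ : ∀ w, Measurable (φ w) := fun w =>
    ((ContinuousMap.continuous_const' (X := Set.Icc (0:ℝ) T)).add continuous_const).measurable
  have hev : ∀ w t, (μ0.map (φ w)).map (evalAt hT.le t) = μ0.map (fun x => x + evalAt hT.le t w) := by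
    intro w t
    rw [Measure.map_map (evalAt_continuous_traj hT.le t).measurable (hφ w)]
    rfl
  have key : ∀ w : Traj d T, evalAt hT.le 0 w = 0 → μ0.map (φ w) = Qmin := by
    intro w hw
    refine hall _ (Measure.isProbabilityMeasure_map (hφ w).aemeasurable) ?_
    rw [hev, hw]; simp
  obtain ⟨R, hR⟩ := hΩc.isBounded.exists_norm_le
  let v : Euc d := EuclideanSpace.single ⟨0, hd⟩ (2 * |R| + 1)
  have hv : ‖v‖ = 2 * |R| + 1 := by
    simp only [v, PiLp.norm_single, Real.norm_eq_abs]
    exact abs_of_pos (by positivity)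
  let w : Traj d T := ⟨fun t => ((t : ℝ) / T) • v, by fun_prop⟩
  have hw0 : evalAt hT.le 0 w = 0 := by
    simp [w, evalAt, projIcc]
  have hwT : evalAt hT.le T w = v := by
    simp [w, evalAt, projIcc, hT.ne', hT.le]
  have e1 := key w hw0
  have e2 := key 0 (by simp [evalAt])
  have e3 : μ0.map (fun x => x + v) = μ0 := by
    have a1 := hev w T
    have a2 := hev 0 T
    rw [e1, hwT] at a1
    rw [e2] at a2
    rw [← a1, a2]
    simp [evalAt]
  have h1 : ∀ᵐ x ∂μ0, x ∈ Ω := hμ0Ω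
  have h2 : ∀ᵐ x ∂μ0, x + v ∈ Ω := by
    have h3 : ∀ᵐ x ∂(μ0.map (fun x => x + v)), x ∈ Ω := by rw [e3]; exact h1
    exact ae_of_ae_map (by fun_prop) h3
  obtain ⟨x, hx1, hx2⟩ := (h1.and h2).exists
  have b1 := hR x hx1
  have b2 := hR _ hx2
  have b3 : ‖v‖ ≤ ‖x + v‖ + ‖x‖ := by
    calc ‖v‖ = ‖(x + v) - x‖ := by simp
      _ ≤ _ := norm_sub_le _ _
  have := le_abs_self R
  linarith

theorem eintegral_ge_const {T : ℝ} (g : ℝ → EReal) {c : ℝ}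
    (hc : ∀ t, ((-c : ℝ) : EReal) ≤ g t) :
    eintegral (volume.restrict (Set.Ioc (0:ℝ) T)) g ≠ ⊥ := by
  have e := eintegral_real (integrable_const (μ := volume.restrict (Set.Ioc (0:ℝ) T)) (-c))
  have h := eintegral_mono (μ := volume.restrict (Set.Ioc (0:ℝ) T))
    (g := fun _ => ((-c : ℝ) : EReal)) (h := g) (by filter_upwards with x using hc _)
  rw [e] at h
  exact ne_bot_of_le_ne_bot (EReal.coe_ne_bot _) h

theorem limsup_core (CT : ℝ) (kN : ℕ → ℝ≥0∞) (k : ℝ≥0∞) (hk : k ≤ liminf kN atTop)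
    (BN : ℕ → EReal) (B : EReal) (hBN : ∀ N, BN N ≠ ⊥) (hB : B ≠ ⊥)
    (gN : ℕ → ℝ) (g : ℝ) (hg : Tendsto gN atTop (𝓝 g))
    (hJ : Tendsto (fun N => (kN N : EReal) - (CT : EReal) + BN N + (gN N : EReal)) atTop
      (𝓝 ((k : EReal) - (CT : EReal) + B + (g : EReal))))
    (hJt : (k : EReal) - (CT : EReal) + B + (g : EReal) ≠ ⊤) (a : EReal) (ha : B < a) :
    ∀ᶠ N in atTop, BN N < a := by
  obtain ⟨hk1, hB1⟩ := sum_finite k CT B g hB hJt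
  lift k to ℝ≥0 using hk1
  lift B to ℝ using ⟨hB1, hB⟩
  obtain ⟨a', ha1, ha2⟩ := EReal.lt_iff_exists_real_btwn.1 ha
  have ha1 : B < a' := by exact_mod_cast ha1
  set η := (a' - B) / 3 with hη
  have hηpos : 0 < η := by rw [hη]; linarith
  have eJ : ((k : ℝ≥0∞) : EReal) - (CT : EReal) + B + (g : EReal)
      = ((k - CT + B + g : ℝ) : EReal) := by
    push_cast; rfl
  rw [eJ] at hJ
  have ev1 := hJ.eventually_lt_const (u := ((k - CT + B + g + η : ℝ) : EReal))
    (by exact_mod_cast (by linarith))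
  have ev2 := hg.eventually_const_lt (u := g - η) (by linarith)
  have ev3 : ∀ᶠ N in atTop, ENNReal.ofReal (k - η) ≤ kN N := by
    by_cases h0 : (k:ℝ) - η ≤ 0
    · filter_upwards with N
      rw [ENNReal.ofReal_of_nonpos h0]; exact zero_le
    · have : ENNReal.ofReal (k - η) < liminf kN atTop := by
        refine lt_of_lt_of_le ?_ hk
        rw [ENNReal.ofReal_lt_iff_lt_toReal (by linarith) ENNReal.coe_ne_top]
        simpa using hηpos
      exact (eventually_lt_of_lt_liminf this).mono fun N h => h.le
  filter_upwards [ev1, ev2, ev3] with N h1 h2 h3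
  obtain ⟨q1, q2⟩ := sum_finite (kN N) CT (BN N) (gN N) (hBN N) (ne_top_of_lt h1)
  refine lt_trans ?_ ha2
  have hb := hBN N
  generalize BN N = b at *
  generalize kN N = κ at *
  lift κ to ℝ≥0 using q1
  lift b to ℝ using ⟨q2, hb⟩
  have h1' : ((κ - CT + b + gN N : ℝ) : EReal) < ((k - CT + B + g + η : ℝ) : EReal) := by
    refine lt_of_eq_of_lt ?_ h1
    push_cast; rfl
  have h1'' : (κ : ℝ) - CT + b + gN N < k - CT + B + g + η := by exact_mod_cast h1'
  have h3' : (k : ℝ) - η ≤ κ := by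
    have := ENNReal.toReal_mono ENNReal.coe_ne_top h3
    exact le_trans (le_max_left _ 0) (by simpa [ENNReal.toReal_ofReal'] using this)
  have : b < a' := by linarith
  exact_mod_cast this

theorem prob_eq_of_subsingleton {X : Type*} [MeasurableSpace X] [Subsingleton X]
    (μ ν : Measure X) [IsProbabilityMeasure μ] [IsProbabilityMeasure ν] : μ = ν := by
  ext s _
  rcases Set.eq_empty_or_nonempty s with rfl | ⟨x, hx⟩
  · simp
  · have : s = univ := by
      ext y; simp [Subsingleton.elim y x, hx]
    simp [this]

/-- **convergence of the congestion terms.** Assume the continuous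
problem `(M_{μ⁰})` has a unique solution `Q_min`, let `Q_N` minimize
`(M_{N,μ⁰_N,ε_N})` with parameters such that `Q_N → Q_min` narrowly and
`J_{ε_N}(Q_N) → J(Q_min)`, and let `ρ_N(t)` be the Moreau projections of `e_t#Q_N`.
Then `∫₀ᵀ∫_Ω f(ρ_N(t)(x)) dx dt → ∫₀ᵀ∫_Ω f((e_t#Q_min)(x)) dx dt`. -/
theorem convergence_of_congestion_terms
    (d : ℕ) (T : ℝ) (hT : 0 < T)
    (Ω : Set (Euc d)) (hΩc : IsCompact Ω) (hΩmeas : MeasurableSet Ω) (hΩne : Ω.Nonempty)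
    (r C : ℝ) (hr : 1 < r) (hC : 0 < C)
    (L : Euc d → ℝ) (hLconv : ConvexOn ℝ Set.univ L) (hLcont : Continuous L)
    (hLgrow : ∀ p : Euc d, 1 / (r * C) * ‖p‖ ^ r - C ≤ L p ∧ L p ≤ C / r * ‖p‖ ^ r + C)
    (f : ℝ → EReal) (hfbot : ∀ t, f t ≠ ⊥) (hfconv : ConvexE f)
    (hflsc : LowerSemicontinuous f) (hfsl : SuperlinearE f)
    (G : Measure (Traj d T) → ℝ)
    (hGcont : ∀ (Q : ℕ → Measure (Traj d T)) (Q' : Measure (Traj d T)),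
      (∀ n, IsProbabilityMeasure (Q n)) → IsProbabilityMeasure Q' →
      NarrowTendsto Q Q' → Tendsto (fun n => G (Q n)) atTop (𝓝 (G Q')))
    (hGbdd : BddBelow (Set.range G))
    (μ0 : Measure (Euc d)) (hμ0 : IsProbabilityMeasure μ0)
    (hμ0Ω : μ0 Ωᶜ = 0) (hμ0ac : μ0 ≪ volume)
    -- `Q_min`, the unique minimizer of the continuous problem
    (Qmin : Measure (Traj d T)) (hQminP : IsProbabilityMeasure Qmin)
    (hQmin0 : Qmin.map (evalAt hT.le 0) = μ0)
    (hQminmin : ∀ Q : Measure (Traj d T), IsProbabilityMeasure Q →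
      Q.map (evalAt hT.le 0) = μ0 →
      JfunE hT.le Ω L C f G Qmin ≤ JfunE hT.le Ω L C f G Q)
    (hQminuniq : ∀ Q : Measure (Traj d T), IsProbabilityMeasure Q →
      Q.map (evalAt hT.le 0) = μ0 →
      (∀ Q' : Measure (Traj d T), IsProbabilityMeasure Q' →
        Q'.map (evalAt hT.le 0) = μ0 →
        JfunE hT.le Ω L C f G Q ≤ JfunE hT.le Ω L C f G Q') → Q = Qmin)
    -- the parameters and the minimizers `Q_N` of the discretized problems
    (ε : ℕ → ℝ) (hεpos : ∀ N, 0 < ε N) (hεlim : Tendsto ε atTop (𝓝 0))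
    (μ0N : ℕ → Measure (Euc d)) (hμ0N : ∀ N, IsUnifDiscrete N (μ0N N) ∧ (μ0N N) Ωᶜ = 0)
    (Q : ℕ → Measure (Traj d T))
    (hQdisc : ∀ N, IsUnifDiscrete N (Q N) ∧ (Q N).map (evalAt hT.le 0) = μ0N N)
    (hQminN : ∀ N, ∀ Q' : Measure (Traj d T), IsUnifDiscrete N Q' →
      Q'.map (evalAt hT.le 0) = μ0N N →
      JepsE hT.le Ω L C f G (ε N) (Q N) ≤ JepsE hT.le Ω L C f G (ε N) Q')
    -- chosen so that `Q_N → Q_min` narrowly and `J_{ε_N}(Q_N) → J(Q_min)`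
    (hQcv : NarrowTendsto Q Qmin)
    (hJcv : Tendsto (fun N => JepsE hT.le Ω L C f G (ε N) (Q N)) atTop
      (𝓝 (JfunE hT.le Ω L C f G Qmin)))
    -- the Moreau projections `ρ_N(t)` of `e_t#Q_N`
    (ρproj : ℕ → ℝ → Measure (Euc d))
    (hproj : ∀ N, ∀ t ∈ Set.Ioc (0:ℝ) T,
      IsProbabilityMeasure (ρproj N t) ∧ (ρproj N t) Ωᶜ = 0 ∧
      (((W2sq ((Q N).map (evalAt hT.le t)) (ρproj N t) / ENNReal.ofReal (2 * ε N))
          : ℝ≥0∞) : EReal) + intFE Ω f (ρproj N t)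
        = moreauE Ω (intFE Ω f) (ε N) ((Q N).map (evalAt hT.le t))) :
    Tendsto
      (fun N => eintegral (volume.restrict (Set.Ioc (0:ℝ) T))
        (fun t => intFE Ω f (ρproj N t)))
      atTop
      (𝓝 (eintegral (volume.restrict (Set.Ioc (0:ℝ) T))
        (fun t => intFE Ω f (Qmin.map (evalAt hT.le t))))) := by
  rcases Nat.eq_zero_or_pos d with rfl | hd
  · have hsub : Subsingleton (Euc 0) := inferInstance
    refine tendsto_const_nhds.congr fun N => ?_
    refine eintegral_congr ?_
    filter_upwards [ae_restrict_mem measurableSet_Ioc] with t ht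
    have h1 := (hproj N t ht).1
    have h2 : IsProbabilityMeasure (Qmin.map (evalAt hT.le t)) :=
      Measure.isProbabilityMeasure_map (evalAt_continuous_traj hT.le t).measurable.aemeasurable
    rw [prob_eq_of_subsingleton (ρproj N t) (Qmin.map (evalAt hT.le t))]
  have hJt := J_ne_top hd hT Ω hΩc (JfunE hT.le Ω L C f G) μ0 hμ0 hμ0Ω Qmin hQminmin hQminuniq
  obtain ⟨c, hc0, hc⟩ := f_bddBelow f hfbot hflsc hfsl
  have hc' := intFE_ge Ω hΩc f hc
  have hvol : volume Ω ≠ 0 := by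
    intro h0
    have h1 := hμ0ac h0
    have h2 : μ0 univ ≤ μ0 Ω + μ0 Ωᶜ := by
      rw [← union_compl_self Ω]; exact measure_union_le _ _
    rw [h1, hμ0Ω, measure_univ] at h2
    simp at h2
  set Q1 : ℕ → Measure (Traj d T) := fun N => Q (N + 1) with hQ1
  have hQP : ∀ N, IsProbabilityMeasure (Q1 N) := fun N => unif_prob N _ (hQdisc (N + 1)).1
  have hQR : ∀ N, ∃ R, ∀ᵐ γ ∂(Q1 N), ‖γ‖ ≤ R := fun N => unif_bound _ _ (hQdisc (N + 1)).1
  have hQcv1 : NarrowTendsto Q1 Qmin := fun φ => (hQcv φ).comp (tendsto_add_atTop_nat 1)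
  have hJcv1 := hJcv.comp (tendsto_add_atTop_nat 1)
  have hkin := kin_liminf hT.le hr hC L hLconv hLcont (fun p => (hLgrow p).1) Q1 Qmin hQP hQminP hQcv1
  have hB : eintegral (volume.restrict (Set.Ioc (0:ℝ) T))
      (fun t => intFE Ω f (Qmin.map (evalAt hT.le t))) ≠ ⊥ :=
    eintegral_ge_const _ (fun t => hc' _)
  have hBN : ∀ N, eintegral (volume.restrict (Set.Ioc (0:ℝ) T))
      (fun t => moreauE Ω (intFE Ω f) (ε (N + 1)) ((Q1 N).map (evalAt hT.le t))) ≠ ⊥ := fun N =>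
    eintegral_ge_const _ (fun t => moreau_ge Ω _ hc' _ _)
  have hfin := (sum_finite _ _ _ _ hB hJt).2
  obtain ⟨s0, hs0⟩ := exists_finite_value hT Ω f hvol _ hfin
  have hup := limsup_core (C * T) _ _ hkin
    (fun N => eintegral (volume.restrict (Set.Ioc (0:ℝ) T))
      (fun t => moreauE Ω (intFE Ω f) (ε (N + 1)) ((Q1 N).map (evalAt hT.le t)))) _ hBN hB
    (fun N => G (Q1 N)) (G Qmin) (hGcont Q1 Qmin hQP hQminP hQcv1) hJcv1 hJt
  rw [← tendsto_add_atTop_iff_nat 1]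
  refine tendsto_order.2 ⟨fun a ha => ?_, fun a ha => ?_⟩
  · obtain ⟨b, hb1, _⟩ := EReal.lt_iff_exists_real_btwn.1 (lt_top_iff_ne_top.2 hfin)
    exact liminf_core hT Ω hΩc hΩmeas f hfbot hfconv hflsc hfsl hs0 hc' Qmin hQminP
      (fun N => ε (N + 1)) (fun N => hεpos _) (hεlim.comp (tendsto_add_atTop_nat 1))
      Q1 hQP hQR hQcv1 (fun N => ρproj (N + 1)) (fun N => hproj (N + 1)) b
      ((hup _ hb1).mono fun N h => h.le) a ha
  · filter_upwards [hup a ha] with N hN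
    refine lt_of_le_of_lt (eintegral_mono ?_) hN
    filter_upwards [ae_restrict_mem measurableSet_Ioc] with t ht
    rw [← (hproj (N + 1) t ht).2.2]
    exact le_add_of_nonneg_left (EReal.coe_ennreal_nonneg _)

end
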